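/- arXiv:2005.07907 — 13 statements merged into one kernel-verified Lean document; each statement's English description precedes it below -/
import Mathlib

section
/- Let i, j, z be integers with i ≥ 1, j ≥ 1 and i + j − 1 ≤ z. Then the Boolean product of the z×z circulant matrices C_{i, z−i} and C_{j, z−j} equals C_{i+j−1, z−i−j+1}; that is, C_{i,z−i} · C_{j,z−j} = C_{i+j−1, z−i−j+1}. -/
/-- The `n × n` circulant 0,1-matrix (as a `Bool`-matrix) whose entry in row `i`,
column `j` is `1` iff `(i - j) mod n < p`.  `Cmat (p+q) p` is the matrix `C_{p,q}`. -/
def Cmat (n p : ℕ) : Matrix (Fin n) (Fin n) Bool :=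
  fun i j => decide ((i.val + n - j.val) % n < p)

/-- A 0,1-matrix `C` of size `n × m` is a submatrix of `A_{k,t}`: there are pairwise
distinct `t`-element subsets `A i` of `[k]` indexing the rows and pairwise distinct
`t`-element subsets `B j` of `[k]` indexing the columns such that `C i j = 1` iff
`A i ∩ B j ≠ ∅`. -/
def IsSubmatrixOfA (k t : ℕ) {n m : ℕ} (C : Matrix (Fin n) (Fin m) Bool) : Prop :=
  ∃ (A : Fin n → Finset (Fin k)) (B : Fin m → Finset (Fin k)),
    Function.Injective A ∧ Function.Injective B ∧
    (∀ i, (A i).card = t) ∧ (∀ j, (B j).card = t) ∧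
    (∀ i j, C i j = true ↔ (A i ∩ B j).Nonempty)

/-- Boolean product of 0,1-matrices: `(X·Y)[i][j] = 1` iff there is `l` with
`X[i][l] = 1` and `Y[l][j] = 1`. -/
def boolMul {n r m : ℕ} (X : Matrix (Fin n) (Fin r) Bool)
    (Y : Matrix (Fin r) (Fin m) Bool) : Matrix (Fin n) (Fin m) Bool :=
  fun i j => decide (∃ l, X i l = true ∧ Y l j = true)

/-- The number of ones in a 0,1-vector. -/
def wt {n : ℕ} (v : Fin n → Bool) : ℕ := (Finset.univ.filter fun a => v a = true).card

/-- A square 0,1-matrix is an isolation matrix: there is a permutation `σ` with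
`B[i][σ i] = 1` for all `i`, and no two of these ones lie in a `2 × 2` all-one
submatrix. -/
def IsIsolation {s : ℕ} (B : Matrix (Fin s) (Fin s) Bool) : Prop :=
  ∃ σ : Equiv.Perm (Fin s), (∀ i, B i (σ i) = true) ∧
    ∀ i j, i ≠ j → ¬(B i (σ j) = true ∧ B j (σ i) = true)

theorem Cmat_eq_true_iff {n p : ℕ} (a b : Fin n) :
    Cmat n p a b = true ↔
      (b.val ≤ a.val ∧ a.val - b.val < p) ∨ (a.val < b.val ∧ a.val + n - b.val < p) := by
  have ha := a.isLt
  have hb := b.isLt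
  simp only [Cmat, decide_eq_true_eq]
  rcases le_or_gt b.val a.val with h | h
  · rw [show a.val + n - b.val = a.val - b.val + n by omega, Nat.add_mod_right,
      Nat.mod_eq_of_lt (by omega)]
    omega
  · rw [Nat.mod_eq_of_lt (by omega)]
    omega

/-- for `i, j ≥ 1` and `i + j - 1 ≤ z`, the Boolean product of the
`z × z` circulant matrices `C_{i,z-i}` and `C_{j,z-j}` equals `C_{i+j-1,z-i-j+1}`. -/
theorem stmt_0 (i j z : ℕ) (hi : 1 ≤ i) (hj : 1 ≤ j) (hz : i + j - 1 ≤ z) :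
    boolMul (Cmat z i) (Cmat z j) = Cmat z (i + j - 1) := by
  ext r c
  have hr := r.isLt
  have hc := c.isLt
  rw [Bool.eq_iff_iff, Cmat_eq_true_iff]
  simp only [boolMul, decide_eq_true_eq, Cmat_eq_true_iff]
  constructor
  · rintro ⟨l, hl⟩
    have hlt := l.isLt
    omega
  · intro h
    by_cases hd : (c.val ≤ r.val ∧ r.val - c.val < j) ∨ (r.val < c.val ∧ r.val + z - c.val < j)
    · exact ⟨r, by omega, hd⟩
    · rcases lt_or_ge (c.val + (j - 1)) z with hl | hl
      · refine ⟨⟨c.val + (j - 1), hl⟩, ?_, ?_⟩ <;> dsimp only <;> omega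
      · refine ⟨⟨c.val + (j - 1) - z, by omega⟩, ?_, ?_⟩ <;> dsimp only <;> omega
end

section
/- Let t ≥ 2 and 2 ≤ p ≤ 2t − 1 be integers, and let k = 2t + p − 2. Then C_{p, p−1} is an isolation matrix of size (2p−1)×(2p−1) and is a submatrix of A_{k,t}. -/
/-- The ones on the diagonal of `C_{p,p-1}` are pairwise isolated. -/
theorem Cmat_isolated {p : ℕ} (i j : Fin (p + (p - 1))) (hij : i ≠ j) :
    ¬(Cmat (p + (p - 1)) p i j = true ∧ Cmat (p + (p - 1)) p j i = true) := by
  have hne : i.val ≠ j.val := fun h => hij (Fin.ext h)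
  have hi := i.isLt
  have hj := j.isLt
  simp only [Cmat, decide_eq_true_eq]
  rintro ⟨h1, h2⟩
  rcases lt_or_gt_of_ne hne with h | h
  · rw [Nat.mod_eq_of_lt (by omega)] at h1
    rw [Nat.mod_eq_sub_mod (by omega), Nat.mod_eq_of_lt (by omega)] at h2
    omega
  · rw [Nat.mod_eq_of_lt (by omega)] at h2
    rw [Nat.mod_eq_sub_mod (by omega), Nat.mod_eq_of_lt (by omega)] at h1
    omega

theorem Cmat_diag {p : ℕ} (i : Fin (p + (p - 1))) : Cmat (p + (p - 1)) p i i = true := by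
  have hi := i.isLt
  simp only [Cmat, decide_eq_true_eq, Nat.add_sub_cancel_left, Nat.mod_self]
  omega

/-- A one in `C_{a+b+1,q}` records that a cyclic interval of `a + 1` points ending at `i` meets the
cyclic interval of `b + 1` points starting at `j`. -/
theorem Cmat_eq_true_iff_s2 {n a b : ℕ} (hn : a + b < n) (i j : Fin n) :
    Cmat n (a + b + 1) i j = true ↔
      ∃ l < a + 1, ∃ m < b + 1, ((i.val : ZMod n) - (l : ZMod n)) = (j.val : ZMod n) + m := by
  have hj := j.isLt
  have key : ∀ d : ℕ, ((i.val + n - j.val) % n = d % n) ↔ (i.val : ZMod n) = j.val + d := by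
    intro d
    rw [← ZMod.natCast_eq_natCast_iff', Nat.cast_sub (by omega), Nat.cast_add, ZMod.natCast_self,
      add_zero, sub_eq_iff_eq_add']
  simp only [Cmat, decide_eq_true_eq]
  constructor
  · intro h
    have hd := (key ((i.val + n - j.val) % n)).1 (Nat.mod_mod _ _).symm
    generalize (i.val + n - j.val) % n = d at h hd
    refine ⟨min d a, by omega, d - min d a, by omega, ?_⟩
    rw [Nat.cast_sub (min_le_left _ _), hd]
    ring
  · rintro ⟨l, hl, m, hm, h⟩
    have := (key (l + m)).2 (by rw [sub_eq_iff_eq_add] at h; rw [h]; push_cast; ring)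
    rw [this, Nat.mod_eq_of_lt (by omega)]
    omega

/-- A matrix whose diagonal is isolated embeds in `A_{k,t}` as soon as its entries record the
intersections of `t`-subsets of some `k`-element type: distinctness of the sets is automatic. -/
theorem isSubmatrixOfA_of_isolated {α : Type*} [Fintype α] [DecidableEq α] {k t n : ℕ}
    (hk : Fintype.card α = k) {C : Matrix (Fin n) (Fin n) Bool} (hdiag : ∀ i, C i i = true)
    (hiso : ∀ i j, i ≠ j → ¬(C i j = true ∧ C j i = true)) (A B : Fin n → Finset α)
    (hA : ∀ i, (A i).card = t) (hB : ∀ j, (B j).card = t)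
    (hAB : ∀ i j, C i j = true ↔ (A i ∩ B j).Nonempty) : IsSubmatrixOfA k t C := by
  let e : α ≃ Fin k := Fintype.equivFinOfCardEq hk
  refine ⟨fun i => (A i).map e.toEmbedding, fun j => (B j).map e.toEmbedding, ?_, ?_, ?_, ?_, ?_⟩
  · intro i j h
    have h : A i = A j := Finset.map_injective _ h
    by_contra hij
    refine hiso i j hij ⟨?_, ?_⟩
    · rw [hAB, h, ← hAB, hdiag]
    · rw [hAB, ← h, ← hAB, hdiag]
  · intro i j h
    have h : B i = B j := Finset.map_injective _ h
    by_contra hij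
    refine hiso i j hij ⟨?_, ?_⟩
    · rw [hAB, ← h, ← hAB, hdiag]
    · rw [hAB, h, ← hAB, hdiag]
  · simpa using hA
  · simpa using hB
  · intro i j
    rw [hAB, ← Finset.map_inter, Finset.map_nonempty]

theorem ZMod.natCast_injOn_range {n c : ℕ} (hc : c ≤ n) :
    Set.InjOn (Nat.cast : ℕ → ZMod n) (Finset.range c) := by
  intro x hx y hy h
  simp only [Finset.coe_range, Set.mem_Iio] at hx hy
  rw [ZMod.natCast_eq_natCast_iff', Nat.mod_eq_of_lt (by omega), Nat.mod_eq_of_lt (by omega)] at h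
  exact h

/-- for `t ≥ 2`, `2 ≤ p ≤ 2t - 1` and `k = 2t + p - 2`, the matrix
`C_{p,p-1}` (of size `(2p-1) × (2p-1)`) is an isolation matrix and is a submatrix
of `A_{k,t}`. -/
theorem stmt_2 (t p k : ℕ) (ht : 2 ≤ t) (hp1 : 2 ≤ p) (hp2 : p ≤ 2 * t - 1)
    (hk : k = 2 * t + p - 2) :
    IsIsolation (Cmat (p + (p - 1)) p) ∧
    IsSubmatrixOfA k t (Cmat (p + (p - 1)) p) := by
  refine ⟨⟨Equiv.refl _, Cmat_diag, Cmat_isolated⟩, ?_⟩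
  obtain ⟨a, b, rfl, ha, hb⟩ : ∃ a b, p = a + b + 1 ∧ a < t ∧ b < t :=
    ⟨(p - 1) / 2, p - 1 - (p - 1) / 2, by omega, by omega, by omega⟩
  have hiff := @Cmat_eq_true_iff_s2 (a + b + 1 + (a + b + 1 - 1)) a b (by omega)
  have hdiag := @Cmat_diag (a + b + 1)
  have hiso := @Cmat_isolated (a + b + 1)
  have hn : a + b + 1 + (a + b + 1 - 1) = 2 * (a + b) + 1 := by omega
  generalize a + b + 1 + (a + b + 1 - 1) = n at *
  have : NeZero n := ⟨by omega⟩
  refine isSubmatrixOfA_of_isolated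
    (α := ZMod n ⊕ (Fin (t - (a + 1)) ⊕ Fin (t - (b + 1))))
    (by simp only [Fintype.card_sum, ZMod.card, Fintype.card_fin]; omega) hdiag hiso
    (fun i => ((Finset.range (a + 1)).image fun l : ℕ => (i.val : ZMod n) - (l : ZMod n)).disjSum
      (Finset.univ.disjSum ∅))
    (fun j => ((Finset.range (b + 1)).image fun m : ℕ => (j.val : ZMod n) + (m : ZMod n)).disjSum
      (Finset.disjSum ∅ Finset.univ)) ?_ ?_ ?_
  · intro i
    rw [Finset.card_disjSum, Finset.card_disjSum, Finset.card_image_of_injOn, Finset.card_range,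
      Finset.card_univ, Fintype.card_fin, Finset.card_empty]
    · omega
    · exact fun x hx y hy h => ZMod.natCast_injOn_range (by omega) hx hy (sub_right_injective h)
  · intro j
    rw [Finset.card_disjSum, Finset.card_disjSum, Finset.card_image_of_injOn, Finset.card_range,
      Finset.card_univ, Fintype.card_fin, Finset.card_empty]
    · omega
    · exact fun x hx y hy h => ZMod.natCast_injOn_range (by omega) hx hy (add_right_injective _ h)
  · intro i j
    rw [hiff]
    constructor
    · rintro ⟨l, hl, m, hm, h⟩
      refine ⟨Sum.inl ((i.val : ZMod n) - (l : ZMod n)), Finset.mem_inter.2 ⟨?_, ?_⟩⟩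
      · exact Finset.inl_mem_disjSum.2 (Finset.mem_image.2 ⟨l, Finset.mem_range.2 hl, rfl⟩)
      · exact Finset.inl_mem_disjSum.2 (Finset.mem_image.2 ⟨m, Finset.mem_range.2 hm, h.symm⟩)
    · rintro ⟨x, hx⟩
      obtain ⟨hxA, hxB⟩ := Finset.mem_inter.1 hx
      rcases x with x | x | x
      · obtain ⟨l, hl, rfl⟩ := Finset.mem_image.1 (Finset.inl_mem_disjSum.1 hxA)
        obtain ⟨m, hm, h⟩ := Finset.mem_image.1 (Finset.inl_mem_disjSum.1 hxB)
        exact ⟨l, Finset.mem_range.1 hl, m, Finset.mem_range.1 hm, h.symm⟩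
      · simp at hxB
      · simp at hxA
end

section
/- Let t ≥ 1 and k ≥ 4t − 3 be integers with k ≥ 2t. Then C_{2t−1, k−2t+1} is an isolation matrix of size k×k and is a submatrix of A_{k,t}. -/
/-- The cyclic distance from `j` up to `i` modulo `k`. -/
def cycDist (k i j : ℕ) : ℕ := if j ≤ i then i - j else i + k - j

theorem Cmat_eq_true_iff_s3 {k p : ℕ} (i j : Fin k) :
    Cmat k p i j = true ↔ cycDist k i j < p := by
  have hi := i.isLt
  have hj := j.isLt
  have h : (i.val + k - j.val) % k = cycDist k i j := by
    unfold cycDist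
    split_ifs with hij
    · rw [show i.val + k - j.val = i.val - j.val + k by omega, Nat.add_mod_right,
        Nat.mod_eq_of_lt (by omega)]
    · exact Nat.mod_eq_of_lt (by omega)
  simp [Cmat, h]

theorem card_filter_cycDist_left {k t : ℕ} (h : t ≤ k) (i : Fin k) :
    (Finset.univ.filter fun x : Fin k => cycDist k i x < t).card = t := by
  have hi := i.isLt
  conv_rhs => rw [← Finset.card_range t]
  refine Finset.card_bij (fun x _ => cycDist k i x) (by simp) ?_ ?_
  · intro x _ y _ hxy
    simp only [cycDist] at hxy
    have hx := x.isLt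
    have hy := y.isLt
    ext
    split_ifs at hxy <;> omega
  · intro s hs
    have hs := Finset.mem_range.1 hs
    have hd : cycDist k i (cycDist k i s) = s := by
      unfold cycDist
      split_ifs <;> omega
    have hlt : cycDist k i s < k := by
      unfold cycDist
      split_ifs <;> omega
    exact ⟨⟨cycDist k i s, hlt⟩, by simp [hd, hs], hd⟩

theorem card_filter_cycDist_right {k t : ℕ} (h : t ≤ k) (j : Fin k) :
    (Finset.univ.filter fun x : Fin k => cycDist k x j < t).card = t := by
  have hj := j.isLt
  conv_rhs => rw [← Finset.card_range t]
  refine Finset.card_bij (fun x _ => cycDist k x j) (by simp) ?_ ?_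
  · intro x _ y _ hxy
    simp only [cycDist] at hxy
    have hx := x.isLt
    have hy := y.isLt
    ext
    split_ifs at hxy <;> omega
  · intro s hs
    have hs := Finset.mem_range.1 hs
    by_cases hsj : j.val + s < k
    · have hd : cycDist k (j.val + s) j = s := by
        unfold cycDist
        split_ifs <;> omega
      exact ⟨⟨j.val + s, hsj⟩, by simp [hd, hs], hd⟩
    · have hd : cycDist k (j.val + s - k) j = s := by
        unfold cycDist
        split_ifs <;> omega
      exact ⟨⟨j.val + s - k, by omega⟩, by simp [hd, hs], hd⟩

theorem cycDist_self (k i : ℕ) : cycDist k i i = 0 := by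
  simp [cycDist]

theorem cycDist_add_cycDist_swap {k : ℕ} {i j : Fin k} (h : i ≠ j) :
    cycDist k i j + cycDist k j i = k := by
  have := Fin.val_ne_of_ne h
  unfold cycDist
  split_ifs <;> omega

theorem isIsolation_Cmat {k p : ℕ} (hp : 0 < p) (h : 2 * p ≤ k + 1) :
    IsIsolation (Cmat k p) := by
  refine ⟨Equiv.refl _, fun i => ?_, fun i j hij => ?_⟩
  · rw [Cmat_eq_true_iff_s3, Equiv.refl_apply, cycDist_self]
    exact hp
  · simp only [Equiv.refl_apply, Cmat_eq_true_iff_s3]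
    have := cycDist_add_cycDist_swap hij
    omega

theorem isSubmatrixOfA_Cmat {k t : ℕ} (ht : 1 ≤ t) (h : 2 * t ≤ k) :
    IsSubmatrixOfA k t (Cmat k (2 * t - 1)) := by
  refine ⟨fun i => Finset.univ.filter fun x => cycDist k i x < t,
    fun j => Finset.univ.filter fun x => cycDist k x j < t, ?_, ?_,
    card_filter_cycDist_left (by omega), card_filter_cycDist_right (by omega), ?_⟩
  · intro i j hij
    by_contra hne
    have hi := Finset.ext_iff.1 hij i
    have hj := Finset.ext_iff.1 hij j
    simp only [Finset.mem_filter, Finset.mem_univ, true_and, cycDist_self] at hi hj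
    have := cycDist_add_cycDist_swap hne
    omega
  · intro i j hij
    by_contra hne
    have hi := Finset.ext_iff.1 hij i
    have hj := Finset.ext_iff.1 hij j
    simp only [Finset.mem_filter, Finset.mem_univ, true_and, cycDist_self] at hi hj
    have := cycDist_add_cycDist_swap hne
    omega
  · intro i j
    have hi := i.isLt
    have hj := j.isLt
    rw [Cmat_eq_true_iff_s3]
    simp only [Finset.Nonempty, Finset.mem_inter, Finset.mem_filter, Finset.mem_univ, true_and]
    constructor
    · intro hd
      by_cases hdt : cycDist k i j < t
      · exact ⟨j, hdt, by rw [cycDist_self]; omega⟩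
      · unfold cycDist at *
        by_cases hjt : j.val + (t - 1) < k
        · refine ⟨⟨j.val + (t - 1), hjt⟩, ?_, ?_⟩ <;> split_ifs at * <;> simp at * <;> omega
        · refine ⟨⟨j.val + (t - 1) - k, by omega⟩, ?_, ?_⟩ <;> split_ifs at * <;> simp at * <;> omega
    · rintro ⟨x, hx, hx'⟩
      have := x.isLt
      unfold cycDist at *
      split_ifs at * <;> omega

/-- for `t ≥ 1`, `k ≥ 4t - 3` and `k ≥ 2t`, the matrix
`C_{2t-1, k-2t+1}` has size `k × k`, is an isolation matrix, and is a submatrix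
of `A_{k,t}`. -/
theorem stmt_3 (t k : ℕ) (ht : 1 ≤ t) (hk1 : 4 * t - 3 ≤ k) (hk2 : 2 * t ≤ k) :
    (2 * t - 1) + (k - 2 * t + 1) = k ∧
    IsIsolation (Cmat ((2 * t - 1) + (k - 2 * t + 1)) (2 * t - 1)) ∧
    IsSubmatrixOfA k t (Cmat ((2 * t - 1) + (k - 2 * t + 1)) (2 * t - 1)) := by
  have hk : (2 * t - 1) + (k - 2 * t + 1) = k := by omega
  rw [hk]
  exact ⟨rfl, isIsolation_Cmat (by omega) (by omega), isSubmatrixOfA_Cmat ht hk2⟩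
end

section
/- Let p, q be positive integers and n = p + q. If I and J are nonempty sets of row indices and column indices of C_{p,q} such that C_{p,q}[i][j] = 1 for every i ∈ I and j ∈ J (i.e., the rows I and columns J induce an all-one submatrix), then |I| ≤ p, |J| ≤ p, and |I| + |J| ≤ p + 1. -/
/-- If the forward orbit of every point under `f` is everything and the iterates `f^[d]`, `d ≤ k`,
all map the nonempty set `S` into the complement of the nonempty set `T`, then
`|S| + |T| + k ≤ |α|`: each application of `f` enlarges the union of images by a new point. -/
theorem card_add_card_le_of_iterate_notMem {α : Type*} [Fintype α] [DecidableEq α] {f : α → α}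
    (hf : ∀ x y, ∃ d, f^[d] x = y) {T : Finset α} (hT : T.Nonempty) (k : ℕ) {S : Finset α}
    (hS : S.Nonempty) (h : ∀ d ≤ k, ∀ x ∈ S, f^[d] x ∉ T) :
    S.card + T.card + k ≤ Fintype.card α := by
  induction k generalizing S with
  | zero =>
    have hd : Disjoint S T := Finset.disjoint_left.2 fun x hx => h 0 le_rfl x hx
    simpa [Finset.card_union_of_disjoint hd] using Finset.card_le_univ (S ∪ T)
  | succ k ih =>
    have hout : ∃ x ∈ S, f x ∉ S := by
      by_contra! hmaps
      obtain ⟨x, hx⟩ := hS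
      obtain ⟨y, hy⟩ := hT
      obtain ⟨d, rfl⟩ := hf x y
      have hd : f^[d] x ∈ S := Set.MapsTo.iterate (s := (S : Set α)) hmaps d hx
      exact h 0 (Nat.zero_le _) _ hd hy
    obtain ⟨x, hx, hfx⟩ := hout
    have hlt : S.card < (S ∪ S.image f).card :=
      Finset.card_lt_card (Finset.ssubset_iff_subset_ne.2 ⟨Finset.subset_union_left, fun he =>
        hfx (he ▸ Finset.mem_union_right _ (Finset.mem_image_of_mem f hx))⟩)
    have := ih (S := S ∪ S.image f) (hS.mono Finset.subset_union_left) fun d hd y hy => by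
      rcases Finset.mem_union.1 hy with hy | hy
      · exact h d (by omega) y hy
      · obtain ⟨z, hz, rfl⟩ := Finset.mem_image.1 hy
        exact h (d + 1) (by omega) z hz
    omega

theorem Fin.val_iterate_add_one {n : ℕ} [NeZero n] (d : ℕ) (x : Fin n) :
    ((fun y : Fin n => y + 1)^[d] x).val = (x.val + d) % n := by
  induction d with
  | zero => simp [Nat.mod_eq_of_lt x.isLt]
  | succ d ih =>
    rw [Function.iterate_succ_apply', Fin.val_add, ih, Fin.val_one', ← Nat.add_mod, add_assoc]

/-- if nonempty row and column index sets `I`, `J` induce an all-one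
submatrix of `C_{p,q}` (with `p, q > 0`), then `|I| ≤ p`, `|J| ≤ p` and
`|I| + |J| ≤ p + 1`. -/
theorem stmt_4 (p q : ℕ) (hp : 0 < p) (hq : 0 < q)
    (I J : Finset (Fin (p + q))) (hI : I.Nonempty) (hJ : J.Nonempty)
    (hall : ∀ i ∈ I, ∀ j ∈ J, Cmat (p + q) p i j = true) :
    I.card ≤ p ∧ J.card ≤ p ∧ I.card + J.card ≤ p + 1 := by
  have : NeZero (p + q) := ⟨by omega⟩
  have htrans : ∀ x y : Fin (p + q), ∃ d, (fun z => z + 1)^[d] x = y := fun x y =>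
    ⟨y.val + (p + q) - x.val, Fin.ext <| by
      rw [Fin.val_iterate_add_one, show x.val + (y.val + (p + q) - x.val) = y.val + (p + q) by omega,
        Nat.add_mod_right, Nat.mod_eq_of_lt y.isLt]⟩
  have havoid : ∀ d ≤ q - 1, ∀ x ∈ I.image (fun z => z + 1), (fun z => z + 1)^[d] x ∉ J := by
    intro d hd x hx hJx
    obtain ⟨i, hi, rfl⟩ := Finset.mem_image.1 hx
    have hone := hall i hi _ hJx
    rw [← Function.iterate_succ_apply (fun z : Fin (p + q) => z + 1)] at hone
    simp only [Cmat, decide_eq_true_eq, Fin.val_iterate_add_one] at hone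
    have hilt := i.isLt
    rcases lt_or_ge (i.val + (d + 1)) (p + q) with hlt | hge
    · rw [Nat.mod_eq_of_lt hlt, Nat.mod_eq_of_lt (by omega)] at hone
      omega
    · rw [Nat.mod_eq_sub_mod hge, Nat.mod_eq_of_lt (a := i.val + (d + 1) - (p + q)) (by omega),
        Nat.mod_eq_sub_mod (by omega), Nat.mod_eq_of_lt (by omega)] at hone
      omega
  have hcard := card_add_card_le_of_iterate_notMem htrans hJ (q - 1) (hI.image _) havoid
  rw [Finset.card_image_of_injective _ (add_left_injective 1), Fintype.card_fin] at hcard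
  have hIpos := hI.card_pos
  have hJpos := hJ.card_pos
  omega
end

section
/- Let p, q be positive integers, n = p + q, and let X·Y = C_{p,q} be a Boolean decomposition where X is an n×r 0,1-matrix with columns x_1,...,x_r and Y is an r×n 0,1-matrix with rows y_1,...,y_r. Then for each i ∈ {1,...,r}: if |x_i| > p then y_i is the all-zero vector, and if |y_i| > p then x_i is the all-zero vector. -/
theorem add_sub_mod_eq_ite {n a b : ℕ} (ha : a < n) (hb : b < n) :
    (a + n - b) % n = if b ≤ a then a - b else a + n - b := by
  split_ifs with h
  · rw [show a + n - b = a - b + n by omega, Nat.add_mod_right, Nat.mod_eq_of_lt (by omega)]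
  · exact Nat.mod_eq_of_lt (by omega)

/-- A 0,1-vector whose support is mapped injectively into `{0, …, p - 1}` has at most
`p` ones. -/
theorem wt_le_of_injective {n p : ℕ} {v : Fin n → Bool} (f : Fin n → ℕ)
    (hf : Function.Injective f) (h : ∀ a, v a = true → f a < p) : wt v ≤ p := by
  simpa [wt] using Finset.card_le_card_of_injOn (t := Finset.range p) f
    (fun a ha => by simpa using h a (by simpa using ha)) hf.injOn

/-- in any Boolean decomposition `X·Y = C_{p,q}` (with `p, q > 0`),
for each index `i`: if column `x_i` of `X` has more than `p` ones then row `y_i`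
of `Y` is all-zero, and if `y_i` has more than `p` ones then `x_i` is all-zero. -/
theorem stmt_5 (p q r : ℕ) (hp : 0 < p) (hq : 0 < q)
    (X : Matrix (Fin (p + q)) (Fin r) Bool) (Y : Matrix (Fin r) (Fin (p + q)) Bool)
    (hXY : boolMul X Y = Cmat (p + q) p) :
    ∀ i : Fin r,
      (p < wt (fun a => X a i) → ∀ b, Y i b = false) ∧
      (p < wt (fun b => Y i b) → ∀ a, X a i = false) := by
  have hlt {l a b} (ha : X a l = true) (hb : Y l b = true) :
      (a.val + (p + q) - b.val) % (p + q) < p := by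
    have h : Cmat (p + q) p a b = true := by
      rw [← hXY]
      exact decide_eq_true ⟨l, ha, hb⟩
    exact of_decide_eq_true h
  refine fun l => ⟨fun hw b => ?_, fun hw a => ?_⟩
  · by_contra hb
    rw [Bool.not_eq_false] at hb
    refine hw.not_ge (wt_le_of_injective (fun a => (a.val + (p + q) - b.val) % (p + q))
      (fun a a' h => ?_) fun a ha => hlt ha hb)
    simp only [add_sub_mod_eq_ite, Fin.is_lt] at h
    split_ifs at h <;> omega
  · by_contra ha
    rw [Bool.not_eq_false] at ha
    refine hw.not_ge (wt_le_of_injective (fun b => (a.val + (p + q) - b.val) % (p + q))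
      (fun b b' h => ?_) fun b hb => hlt ha hb)
    simp only [add_sub_mod_eq_ite, Fin.is_lt] at h
    split_ifs at h <;> omega
end

section
/- Let p, q be positive integers, n = p + q, and let X·Y = C_{p,q} be a Boolean decomposition where X is an n×r 0,1-matrix with columns x_1,...,x_r and Y is an r×n 0,1-matrix with rows y_1,...,y_r. Then for each i ∈ {1,...,r}: if |x_i| > 0 and |y_i| > 0, then |x_i| + |y_i| ≤ p + 1. -/
/-- Two sets of residues modulo `p + q`, one of which lies below `p`, all of whose pairwise sums
reduce to residues below `p`, have at most `p + 1` elements together. -/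
lemma card_add_card_le_of_add_mod_lt {p q : ℕ} (hq : 0 < q) {U V : Finset ℕ}
    (hU : U.Nonempty) (hV : ∀ v ∈ V, v < p + q) (hUp : ∀ u ∈ U, u < p)
    (h : ∀ u ∈ U, ∀ v ∈ V, (u + v) % (p + q) < p) : V.card + U.card ≤ p + 1 := by
  obtain ⟨m, hm, hmax⟩ := U.exists_max_image id hU
  simp only [id] at hmax
  have hmp := hUp m hm
  have avoid : ∀ u ∈ U, ∀ v ∈ V, p ≤ u + v → p + q ≤ u + v := by
    intro u hu v hv hle
    by_contra hlt
    have := h u hu v hv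
    rw [Nat.mod_eq_of_lt (by omega)] at this
    omega
  let W := (U.erase m).image fun u => p + q - 1 - u
  have hW : W.card = U.card - 1 := by
    rw [Finset.card_image_of_injOn, Finset.card_erase_of_mem hm]
    intro a ha b hb hab
    have := hUp a (Finset.mem_of_mem_erase ha)
    have := hUp b (Finset.mem_of_mem_erase hb)
    dsimp only at hab
    omega
  have hIW : Disjoint (Finset.Ico (p - m) (p + q - m)) W := by
    rw [Finset.disjoint_left]
    intro x hx hxW
    obtain ⟨u, hu, rfl⟩ := Finset.mem_image.1 hxW
    rw [Finset.mem_erase] at hu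
    have := hmax u hu.2
    rw [Finset.mem_Ico] at hx
    omega
  have hVIW : Disjoint V (Finset.Ico (p - m) (p + q - m) ∪ W) := by
    rw [Finset.disjoint_left]
    intro x hx hxIW
    rcases Finset.mem_union.1 hxIW with hxI | hxW
    · rw [Finset.mem_Ico] at hxI
      have := avoid m hm x hx
      omega
    · obtain ⟨u, hu, rfl⟩ := Finset.mem_image.1 hxW
      have huU := Finset.mem_of_mem_erase hu
      have := hUp u huU
      have := avoid u huU _ hx
      omega
  have hsub : V ∪ (Finset.Ico (p - m) (p + q - m) ∪ W) ⊆ Finset.range (p + q) := by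
    intro x hx
    rw [Finset.mem_range]
    rcases Finset.mem_union.1 hx with hx | hx
    · exact hV x hx
    rcases Finset.mem_union.1 hx with hx | hx
    · rw [Finset.mem_Ico] at hx
      omega
    · obtain ⟨u, -, rfl⟩ := Finset.mem_image.1 hx
      omega
  have hcard := Finset.card_le_card hsub
  rw [Finset.card_union_of_disjoint hVIW, Finset.card_union_of_disjoint hIW, hW,
    Nat.card_Ico, Finset.card_range] at hcard
  have := hU.card_pos
  omega

/-- Cyclic differences modulo `n` telescope. -/
lemma cyclic_sub_add_cyclic_sub {n a b c : ℕ} (hb : b < n) (hc : c < n) :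
    ((b + n - c) % n + (a + n - b) % n) % n = (a + n - c) % n := by
  rw [← Nat.add_mod, show b + n - c + (a + n - b) = a + n - c + n by omega,
    Nat.add_mod_right]

/-- The row and column sets of a nonempty all-ones submatrix of `C_{p,q}` have at most `p + 1`
elements together. -/
lemma card_add_card_le_of_forall_Cmat {p q : ℕ} (hq : 0 < q) {S T : Finset (Fin (p + q))}
    (hS : S.Nonempty) (hT : T.Nonempty)
    (h : ∀ s ∈ S, ∀ t ∈ T, Cmat (p + q) p s t = true) : S.card + T.card ≤ p + 1 := by
  obtain ⟨c, hc⟩ := hS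
  have hlt : ∀ s ∈ S, ∀ t ∈ T, (s.val + (p + q) - t.val) % (p + q) < p := fun s hs t ht => by
    simpa [Cmat] using h s hs t ht
  have mod_cases : ∀ a b : Fin (p + q),
      (b ≤ a ∧ (a.val + (p + q) - b.val) % (p + q) = a.val - b.val) ∨
      (a < b ∧ (a.val + (p + q) - b.val) % (p + q) = a.val + (p + q) - b.val) := by
    intro a b
    rcases le_or_gt b a with hba | hab
    · refine Or.inl ⟨hba, ?_⟩
      rw [show a.val + (p + q) - b.val = a.val - b.val + (p + q) by omega,
        Nat.add_mod_right, Nat.mod_eq_of_lt (by omega)]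
    · exact Or.inr ⟨hab, Nat.mod_eq_of_lt (by omega)⟩
  have hSinj : Function.Injective fun s : Fin (p + q) => (s.val + (p + q) - c.val) % (p + q) := by
    intro a b hab
    dsimp only at hab
    have := mod_cases a c
    have := mod_cases b c
    omega
  have hTinj : Function.Injective fun t : Fin (p + q) => (c.val + (p + q) - t.val) % (p + q) := by
    intro a b hab
    dsimp only at hab
    have := mod_cases c a
    have := mod_cases c b
    omega
  rw [← Finset.card_image_of_injective S hSinj, ← Finset.card_image_of_injective T hTinj]
  refine card_add_card_le_of_add_mod_lt hq (hT.image _) ?_ ?_ ?_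
  · rintro _ hv
    obtain ⟨s, -, rfl⟩ := Finset.mem_image.1 hv
    exact Nat.mod_lt _ (by omega)
  · rintro _ hu
    obtain ⟨t, ht, rfl⟩ := Finset.mem_image.1 hu
    exact hlt c hc t ht
  · rintro _ hu _ hv
    obtain ⟨t, ht, rfl⟩ := Finset.mem_image.1 hu
    obtain ⟨s, hs, rfl⟩ := Finset.mem_image.1 hv
    rw [cyclic_sub_add_cyclic_sub c.isLt t.isLt]
    exact hlt s hs t ht


/-- in any Boolean decomposition `X·Y = C_{p,q}` (with `p, q > 0`),
for each index `i`, if column `x_i` of `X` and row `y_i` of `Y` are both nonzero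
then `|x_i| + |y_i| ≤ p + 1`. -/
theorem stmt_6 (p q r : ℕ) (hp : 0 < p) (hq : 0 < q)
    (X : Matrix (Fin (p + q)) (Fin r) Bool) (Y : Matrix (Fin r) (Fin (p + q)) Bool)
    (hXY : boolMul X Y = Cmat (p + q) p) :
    ∀ i : Fin r, 0 < wt (fun a => X a i) → 0 < wt (fun b => Y i b) →
      wt (fun a => X a i) + wt (fun b => Y i b) ≤ p + 1 := by
  intro i hx hy
  refine card_add_card_le_of_forall_Cmat hq (Finset.card_pos.1 hx) (Finset.card_pos.1 hy) ?_
  intro s hs t ht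
  rw [← hXY]
  exact decide_eq_true ⟨i, (Finset.mem_filter.1 hs).2, (Finset.mem_filter.1 ht).2⟩
end

section
/- Let k, t, p, q be integers with k ≥ t ≥ 1, p ≥ 1 and q ≥ 1. If C_{p,q} is a submatrix of A_{k,t}, then p ≤ C(2t, t) − 1; equivalently, the size n = p + q of C_{p,q} satisfies n ≤ C(2t, t) + q − 1, where C(2t, t) is the binomial coefficient '2t choose t'. -/
/-- The coefficients of the monic polynomial over `ℚ` whose roots are the elements of `A`. -/
noncomputable def rootCoeff {k : ℕ} (A : Finset (Fin k)) (s : ℕ) : ℚ :=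
  (∏ a ∈ A, (Polynomial.X - Polynomial.C (a.val : ℚ))).coeff s

theorem sum_rootCoeff_mul_pow {k t : ℕ} (A : Finset (Fin k)) (hA : A.card = t) (x : ℚ) :
    ∑ s : Fin (t + 1), rootCoeff A s * x ^ s.val = ∏ a ∈ A, (x - (a.val : ℚ)) := by
  have hdeg : (∏ a ∈ A, (Polynomial.X - Polynomial.C (a.val : ℚ))).natDegree < t + 1 := by
    rw [Polynomial.natDegree_finsetProd_X_sub_C_eq_card, hA]
    exact Nat.lt_succ_self t
  have h := Polynomial.eval_eq_sum_range' hdeg x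
  rw [Finset.sum_range, Polynomial.eval_prod] at h
  simpa [rootCoeff] using h.symm

theorem prod_sub_ne_zero_iff_disjoint {k : ℕ} (A B : Finset (Fin k)) :
    (∏ b ∈ B, ∏ a ∈ A, ((b.val : ℚ) - (a.val : ℚ))) ≠ 0 ↔ Disjoint A B := by
  simp only [Finset.prod_ne_zero_iff, sub_ne_zero, ne_eq, Nat.cast_inj, ← Fin.ext_iff,
    Finset.disjoint_left]
  exact ⟨fun h a ha hb => h a hb a ha rfl, fun h b hb a ha e => h ha (e ▸ hb)⟩

/-- A product of linear forms is a combination of the monomials indexed by multisets. -/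
theorem prod_linear_mem_span_monomials {ι σ κ : Type*} [Fintype ι] [Fintype σ] {t : ℕ}
    (hι : Fintype.card ι = t) (c : ι → σ → ℚ) (y : κ → σ → ℚ) :
    (fun i => ∏ b, ∑ s, y i s * c b s) ∈
      Submodule.span ℚ (Set.range fun (m : Sym σ t) (i : κ) =>
        ((m : Multiset σ).map (y i)).prod) := by
  classical
  have h : (fun i => ∏ b, ∑ s, y i s * c b s) =
      ∑ g : ι → σ, (∏ b, c b (g b)) • fun i => ∏ b, y i (g b) := by
    ext i
    rw [Finset.prod_univ_sum, Fintype.piFinset_univ, Finset.sum_apply]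
    refine Finset.sum_congr rfl fun g _ => ?_
    rw [Finset.prod_mul_distrib, Pi.smul_apply, smul_eq_mul, mul_comm]
  rw [h]
  refine Submodule.sum_mem _ fun g _ => Submodule.smul_mem _ _ (Submodule.subset_span ?_)
  refine ⟨⟨Finset.univ.val.map g, by simp [hι]⟩, ?_⟩
  ext i
  simp only [Sym.coe_mk, Multiset.map_map]
  rfl

/-- The uniform skew Bollobás inequality for pairs of `t`-element sets. -/
theorem skew_bollobas {k t N : ℕ} (A B : Fin N → Finset (Fin k))
    (hA : ∀ i, (A i).card = t) (hB : ∀ i, (B i).card = t)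
    (hdisj : ∀ i, Disjoint (A i) (B i)) (hmeet : ∀ i j, j < i → ¬ Disjoint (A i) (B j)) :
    N ≤ Nat.choose (2 * t) t := by
  let M : Matrix (Fin N) (Fin N) ℚ := fun j i =>
    ∏ b ∈ B j, ∏ a ∈ A i, ((b.val : ℚ) - (a.val : ℚ))
  have htri : M.BlockTriangular OrderDual.toDual := fun j i hij => by
    by_contra hne
    exact hmeet i j hij ((prod_sub_ne_zero_iff_disjoint _ _).1 hne)
  have hdet : M.det ≠ 0 := by
    rw [Matrix.det_of_isLowerTriangular M htri, Finset.prod_ne_zero_iff]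
    exact fun i _ => (prod_sub_ne_zero_iff_disjoint _ _).2 (hdisj i)
  have hli : LinearIndependent ℚ M.row :=
    Matrix.linearIndependent_rows_iff_isUnit.2
      ((Matrix.isUnit_iff_isUnit_det M).2 hdet.isUnit)
  let φ : Sym (Fin (t + 1)) t → Fin N → ℚ := fun m i =>
    ((m : Multiset (Fin (t + 1))).map fun s : Fin (t + 1) => rootCoeff (A i) s.val).prod
  have hspan : Set.range M.row ≤ Submodule.span ℚ (Set.range φ) := by
    rintro _ ⟨j, rfl⟩
    have hrow : M.row j = fun i => ∏ b : B j, ∑ s : Fin (t + 1),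
        rootCoeff (A i) s * (b.val.val : ℚ) ^ s.val := by
      ext i
      simp only [sum_rootCoeff_mul_pow (A i) (hA i)]
      exact (Finset.prod_coe_sort (B j) fun b => ∏ a ∈ A i, ((b.val : ℚ) - (a.val : ℚ))).symm
    rw [hrow, SetLike.mem_coe]
    have hj : Fintype.card (B j) = t := by rw [Fintype.card_coe, hB]
    convert prod_linear_mem_span_monomials hj
      (fun (b : B j) (s : Fin (t + 1)) => (b.val.val : ℚ) ^ s.val)
      fun i s => rootCoeff (A i) s.val
  have hle := linearIndependent_le_span' M.row hli (Set.range φ) hspan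
  have hcard : Fintype.card (Set.range φ) ≤ Fintype.card (Sym (Fin (t + 1)) t) :=
    Fintype.card_range_le φ
  rw [Sym.card_sym_eq_choose, Fintype.card_fin] at hcard
  have h2 : t + 1 + t - 1 = 2 * t := by omega
  rw [h2] at hcard
  simp only [Cardinal.mk_fin, Nat.cast_le] at hle
  exact hle.trans hcard

/-- for `k ≥ t ≥ 1`, `p ≥ 1` and `q ≥ 1`, if `C_{p,q}` is a
submatrix of `A_{k,t}` then `p ≤ C(2t,t) - 1`, i.e. `n = p + q ≤ C(2t,t) + q - 1`. -/
theorem stmt_11 (k t p q : ℕ) (ht : 1 ≤ t) (hkt : t ≤ k) (hp : 1 ≤ p) (hq : 1 ≤ q)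
    (h : IsSubmatrixOfA k t (Cmat (p + q) p)) :
    p ≤ Nat.choose (2 * t) t - 1 ∧ p + q ≤ Nat.choose (2 * t) t + q - 1 := by
  obtain ⟨A, B, -, -, hA, hB, hAB⟩ := h
  have hiff : ∀ i j, Disjoint (A i) (B j) ↔ ¬ (i.val + (p + q) - j.val) % (p + q) < p := by
    intro i j
    rw [Finset.disjoint_iff_inter_eq_empty, ← Finset.not_nonempty_iff_eq_empty, ← hAB]
    simp [Cmat]
  have hbound : p + 1 ≤ Nat.choose (2 * t) t := by
    refine skew_bollobas (N := p + 1) (fun i => A ⟨i.val, by omega⟩)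
      (fun j => B ⟨(j.val + 1) % (p + q), Nat.mod_lt _ (by omega)⟩)
      (fun _ => hA _) (fun _ => hB _) (fun i => ?_) fun i j hji => ?_
    · rw [hiff]
      have hi := i.isLt
      rcases Nat.lt_or_ge (i.val + 1) (p + q) with hlt | hge
      · simp only [Nat.mod_eq_of_lt hlt]
        rw [Nat.mod_eq_of_lt (by omega)]
        omega
      · have he : i.val + 1 = p + q := by omega
        simp only [he, Nat.mod_self, Nat.sub_zero, Nat.add_mod_right]
        rw [Nat.mod_eq_of_lt (by omega)]
        omega
    · rw [hiff, not_not]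
      have hi := i.isLt
      have hlt : j.val < i.val := hji
      simp only [Nat.mod_eq_of_lt (show j.val + 1 < p + q by omega)]
      rw [show i.val + (p + q) - (j.val + 1) = i.val - (j.val + 1) + (p + q) by omega,
        Nat.add_mod_right, Nat.mod_eq_of_lt (by omega)]
      omega
  omega
end

section
/- Let q and t be integers with q > 0, t ≥ q and q dividing t, and set p = q·(C(2t/q, t/q) − 1), where C(a, b) denotes the binomial coefficient. Then for every integer k ≥ 3t − t/q, C_{p,q} is a submatrix of A_{k,t}. -/
/-- To realise a matrix inside `A_{k,t}` one may replace `[k]` by any type of size at most `k`. -/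
theorem isSubmatrixOfA_of_card_le {k t n m : ℕ} {C : Matrix (Fin n) (Fin m) Bool}
    {α : Type*} [Fintype α] [DecidableEq α] (hα : Fintype.card α ≤ k)
    (A : Fin n → Finset α) (B : Fin m → Finset α)
    (hA : Function.Injective A) (hB : Function.Injective B)
    (hAc : ∀ i, (A i).card = t) (hBc : ∀ j, (B j).card = t)
    (h : ∀ i j, C i j = true ↔ (A i ∩ B j).Nonempty) : IsSubmatrixOfA k t C := by
  obtain ⟨f⟩ : Nonempty (α ↪ Fin k) :=
    Function.Embedding.nonempty_of_card_le (by simpa using hα)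
  refine ⟨fun i => (A i).map f, fun j => (B j).map f, ?_, ?_, ?_, ?_, ?_⟩
  · exact (Finset.map_injective f).comp hA
  · exact (Finset.map_injective f).comp hB
  · simpa using hAc
  · simpa using hBc
  · intro i j
    rw [h, ← Finset.map_inter, Finset.map_nonempty]

/-- There is an `N`-periodic enumeration of the `s`-subsets of an `m`-set, `N = C(m, s)`. -/
theorem exists_periodic_enumeration_powersetCard (m s : ℕ) (hs : s ≤ m) :
    ∃ S : ℕ → Finset (Fin m), (∀ x, (S x).card = s) ∧
      ∀ x y, S x = S y ↔ x ≡ y [MOD m.choose s] := by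
  have hc : Fintype.card (Finset.powersetCard s (Finset.univ : Finset (Fin m))) = m.choose s := by
    simp
  have hN : 0 < m.choose s := Nat.choose_pos hs
  let e := (Fintype.equivFinOfCardEq hc).symm
  refine ⟨fun x => (e ⟨x % m.choose s, Nat.mod_lt _ hN⟩).1, fun x => ?_, fun x y => ?_⟩
  · exact (Finset.mem_powersetCard.1 (e ⟨x % m.choose s, Nat.mod_lt _ hN⟩).2).2
  · rw [Subtype.val_inj, e.apply_eq_iff_eq, Fin.mk.injEq, Nat.ModEq]

/-- Two sets of equal size differ iff one meets the complement of the other. -/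
theorem inter_compl_nonempty_iff_ne {α : Type*} [Fintype α] [DecidableEq α] {X Y : Finset α}
    (h : X.card = Y.card) : (X ∩ Yᶜ).Nonempty ↔ X ≠ Y := by
  rw [← Finset.sdiff_eq_inter_compl, Finset.sdiff_nonempty, not_iff_not]
  exact ⟨fun hXY => Finset.eq_of_subset_of_card_le hXY h.ge, fun hXY => hXY.subset⟩

/-- The zeros of the circulant `C_{q(N-1),q}`, with the column shifted by one and split
into quotient and remainder modulo `q`. -/
theorem circulant_entry_iff {q N i j : ℕ} (hq : 0 < q) (hN : 0 < N) (hj : j < q * N) :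
    (i + q * N - j) % (q * N) < q * (N - 1) ↔
      ¬ (i + (q - 1 - (j + q * N - 1) % q)) / q ≡ (j + q * N - 1) / q [MOD N] := by
  have key : (i + q * N - j) / q + 1 + (j + q * N - 1) / q =
      (i + (q - 1 - (j + q * N - 1) % q)) / q + N + N := by
    have hc := Nat.mod_lt (j + q * N - 1) hq
    have hJ := Nat.div_add_mod (j + q * N - 1) q
    generalize (j + q * N - 1) / q = b at *
    generalize (j + q * N - 1) % q = c at *
    have hr := Nat.mod_lt i hq
    have hi := Nat.div_add_mod i q
    generalize i / q = a at *
    generalize i % q = r at *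
    have hbN : b < 2 * N := by
      by_contra! hb
      have := Nat.mul_le_mul_left q hb
      have e : q * (2 * N) = q * N + q * N := by ring
      omega
    obtain ⟨d, hd⟩ := Nat.exists_eq_add_of_lt hbN
    have e1 : q * b + q * d + q = q * N + q * N := by
      calc q * b + q * d + q = q * (b + d + 1) := by ring
        _ = q * N + q * N := by rw [← hd]; ring
    rcases lt_or_ge c r with hcr | hcr
    · have h1 : (i + q * N - j) / q = a + d + 1 := by
        rw [show i + q * N - j = q * (a + d + 1) + (r - c - 1) by
          have : q * (a + d + 1) = q * a + q * d + q := by ring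
          omega, Nat.mul_add_div hq, Nat.div_eq_of_lt (by omega)]
      have h2 : (i + (q - 1 - c)) / q = a + 1 := by
        rw [show i + (q - 1 - c) = q * (a + 1) + (r - c - 1) by
          have : q * (a + 1) = q * a + q := by ring
          omega, Nat.mul_add_div hq, Nat.div_eq_of_lt (by omega)]
      omega
    · have h1 : (i + q * N - j) / q = a + d := by
        rw [show i + q * N - j = q * (a + d) + (q + r - c - 1) by
          have : q * (a + d) = q * a + q * d := by ring
          omega, Nat.mul_add_div hq, Nat.div_eq_of_lt (by omega)]
        rfl
      have h2 : (i + (q - 1 - c)) / q = a := by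
        rw [show i + (q - 1 - c) = q * a + (q + r - c - 1) by omega, Nat.mul_add_div hq,
          Nat.div_eq_of_lt (by omega)]
        rfl
      omega
  have hlt := Nat.mod_lt ((i + q * N - j) / q) hN
  have hdiv := Nat.div_add_mod ((i + q * N - j) / q) N
  rw [mul_comm q (N - 1), ← Nat.div_lt_iff_lt_mul hq, Nat.mod_mul_right_div_self,
    show ((i + q * N - j) / q % N < N - 1) ↔ ¬ (i + q * N - j) / q % N = N - 1 by omega, not_iff_not]
  generalize (i + q * N - j) / q = x at *
  generalize (j + q * N - 1) / q = b at *
  generalize (i + (q - 1 - (j + q * N - 1) % q)) / q = u at *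
  have h1 : u ≡ b [MOD N] ↔ x + 1 ≡ 0 [MOD N] := by
    have h2 : u ≡ x + 1 + b [MOD N] := by
      rw [key]; simp [Nat.ModEq]
    refine ⟨fun h => ?_, fun h => ?_⟩
    · have := h2.symm.trans h
      exact Nat.ModEq.add_right_cancel' b (by simpa using this)
    · simpa using h2.trans (h.add_right b)
  rw [h1, Nat.modEq_zero_iff_dvd]
  constructor
  · intro h
    exact ⟨x / N + 1, by rw [mul_add]; omega⟩
  · intro h
    have : N ∣ x % N + 1 := by
      rw [← hdiv, add_assoc] at h
      exact (Nat.dvd_add_right (dvd_mul_right _ _)).1 h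
    have := Nat.le_of_dvd (by omega) this
    omega

/-- For `N ≥ 2`, the shifted quotients `⌊(i + c) / q⌋` modulo `N` determine `i < q * N`. -/
theorem eq_of_shifted_div_modEq {q N i i' : ℕ} (hq : 0 < q) (hN : 2 ≤ N) (hi : i < q * N)
    (hi' : i' < q * N) (h : ∀ c < q, (i + c) / q ≡ (i' + c) / q [MOD N]) : i = i' := by
  wlog hle : i ≤ i' generalizing i i'
  · exact (this hi' hi (fun c hc => (h c hc).symm) (le_of_not_ge hle)).symm
  by_contra hne
  have hlt := lt_of_le_of_ne hle hne
  have h0 : i / q = i' / q := (by simpa using h 0 hq : i / q ≡ i' / q [MOD N]).eq_of_lt_of_lt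
    (Nat.div_lt_of_lt_mul hi) (Nat.div_lt_of_lt_mul hi')
  have hr := Nat.mod_lt i hq
  have hr' := Nat.mod_lt i' hq
  have e := Nat.div_add_mod i q
  have e' := Nat.div_add_mod i' q
  rw [← h0] at e'
  generalize i / q = a at *
  have hc := h (q - 1 - i % q) (by omega)
  have h1 : (i + (q - 1 - i % q)) / q = a := by
    rw [show i + (q - 1 - i % q) = q * a + (q - 1) by omega, Nat.mul_add_div hq,
      Nat.div_eq_of_lt (by omega)]
    rfl
  have h2 : (i' + (q - 1 - i % q)) / q = a + 1 := by
    rw [show i' + (q - 1 - i % q) = q * (a + 1) + (i' % q - i % q - 1) by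
      have : q * (a + 1) = q * a + q := by ring
      omega, Nat.mul_add_div hq, Nat.div_eq_of_lt (by omega)]
  rw [h1, h2] at hc
  have := (Nat.modEq_iff_dvd' (by omega)).1 hc
  simp at this
  omega

/-- for `q > 0`, `t ≥ q` with `q ∣ t` and
`p = q·(C(2t/q, t/q) - 1)`, for every `k ≥ 3t - t/q` the matrix `C_{p,q}` is a
submatrix of `A_{k,t}`. -/
theorem stmt_12 (q t p : ℕ) (hq : 0 < q) (hqt : q ≤ t) (hdvd : q ∣ t)
    (hp : p = q * (Nat.choose (2 * (t / q)) (t / q) - 1)) :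
    ∀ k : ℕ, 3 * t - t / q ≤ k → IsSubmatrixOfA k t (Cmat (p + q) p) := by
  intro k hk
  obtain ⟨s, rfl⟩ := hdvd
  rw [Nat.mul_div_cancel_left s hq] at hp hk
  have hs : 0 < s := Nat.pos_of_ne_zero (by rintro rfl; simp at hqt; omega)
  obtain ⟨S, hSc, hS⟩ := exists_periodic_enumeration_powersetCard (2 * s) s (by omega)
  have hN : 2 ≤ (2 * s).choose s := Nat.two_le_centralBinom s hs
  generalize (2 * s).choose s = N at *
  have hn : p + q = q * N := by
    rw [hp]
    nth_rewrite 2 [← mul_one q]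
    rw [← mul_add, Nat.sub_add_cancel (by omega)]
  rw [hn, hp]
  have hqs : s + (q - 1) * s = q * s := by
    obtain ⟨r, rfl⟩ := Nat.exists_eq_add_of_lt hq
    simp; ring
  refine isSubmatrixOfA_of_card_le (α := (Σ _ : Fin q, Fin (2 * s)) ⊕ Fin ((q - 1) * s)) ?_
    (fun i => (Finset.univ.sigma fun c : Fin q => S ((i + (q - 1 - c)) / q)).disjSum ∅)
    (fun j => (Finset.sigma {⟨(j + q * N - 1) % q, Nat.mod_lt _ hq⟩}
      fun _ => (S ((j + q * N - 1) / q))ᶜ).disjSum Finset.univ) ?_ ?_ ?_ ?_ ?_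
  · have : q * (2 * s) = q * s + q * s := by ring
    simp
    omega
  · intro i i' h
    have h' : ∀ c : Fin q, S ((i + (q - 1 - c)) / q) = S ((i' + (q - 1 - c)) / q) := by
      intro c
      ext x
      have := Finset.ext_iff.1 h (Sum.inl ⟨c, x⟩)
      simpa using this
    refine Fin.ext (eq_of_shifted_div_modEq hq hN i.2 i'.2 fun c hc => ?_)
    have := (hS _ _).1 (h' ⟨q - 1 - c, by omega⟩)
    simpa [show q - 1 - (q - 1 - c) = c by omega] using this
  · intro j j' h
    have h' : ∀ (c : Fin q) x,
        (c.1 = (j + q * N - 1) % q ∧ x ∉ S ((j + q * N - 1) / q)) ↔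
        (c.1 = (j' + q * N - 1) % q ∧ x ∉ S ((j' + q * N - 1) / q)) := by
      intro c x
      have := Finset.ext_iff.1 h (Sum.inl ⟨c, x⟩)
      simpa [Fin.ext_iff] using this
    have hne : (S ((j + q * N - 1) / q))ᶜ.Nonempty := by
      rw [← Finset.card_pos, Finset.card_compl, hSc]
      simp; omega
    obtain ⟨x, hx⟩ := hne
    have hc : (j + q * N - 1) % q = (j' + q * N - 1) % q :=
      ((h' ⟨_, Nat.mod_lt _ hq⟩ x).1 ⟨rfl, by simpa using hx⟩).1
    have hb : S ((j + q * N - 1) / q) = S ((j' + q * N - 1) / q) := by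
      ext x
      have := h' ⟨_, Nat.mod_lt (j + q * N - 1) hq⟩ x
      simp only [hc, true_and] at this
      exact not_iff_not.1 this
    rw [hS] at hb
    have hJ : j + q * N - 1 ≡ j' + q * N - 1 [MOD q * N] := by
      rw [Nat.ModEq, Nat.mod_mul, Nat.mod_mul, hc, hb]
    have hpos : 0 < q * N := by positivity
    have hj : (j : ℕ) + q * N ≡ j' + q * N [MOD q * N] := by
      simpa [Nat.sub_add_cancel (show 1 ≤ (j : ℕ) + q * N by omega),
        Nat.sub_add_cancel (show 1 ≤ (j' : ℕ) + q * N by omega)] using hJ.add_right 1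
    exact Fin.ext ((Nat.ModEq.add_right_cancel' _ hj).eq_of_lt_of_lt j.2 j'.2)
  · intro i
    simp [hSc]
  · intro j
    simp [hSc, Finset.card_compl]
    omega
  · intro i j
    rw [Cmat, decide_eq_true_iff, circulant_entry_iff hq (by omega) j.2, ← hS, ← ne_eq,
      ← inter_compl_nonempty_iff_ne (by rw [hSc, hSc])]
    constructor
    · rintro ⟨x, hx⟩
      exact ⟨Sum.inl ⟨⟨(j + q * N - 1) % q, Nat.mod_lt _ hq⟩, x⟩, by simpa using hx⟩
    · rintro ⟨⟨c, x⟩ | y, hx⟩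
      · simp only [Finset.mem_inter, Finset.inl_mem_disjSum, Finset.mem_sigma, Finset.mem_univ,
          true_and, Finset.mem_singleton] at hx
        obtain ⟨h1, rfl, h2⟩ := hx
        exact ⟨x, Finset.mem_inter.2 ⟨h1, h2⟩⟩
      · simp at hx
end

section
/- Let t > 2 be an integer, q = 2 and p = 2^t + 2^{t−2} − 2. Then there exists an integer k₀ such that for every k ≥ k₀, C_{p,2} is a submatrix of A_{k,t}. -/
/-- A set-theoretic Gray code: `P` represents the vertices, `Q` the single vertices and `E` the
edges of a Hamiltonian path of the `m`-dimensional hypercube. -/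
theorem exists_gray_sets (m : ℕ) : ∃ P Q E : ℕ → Finset ℕ, ∀ r < 2 ^ m,
    (P r).card = m ∧ (Q r).card = m ∧ P r ⊆ Finset.range (2 * m) ∧ Q r ⊆ Finset.range (2 * m) ∧
    (r + 1 < 2 ^ m → (E r).card + 1 = m ∧ E r ⊆ Finset.range (2 * m)) ∧
    ∀ s < 2 ^ m, (Disjoint (P s) (Q r) ↔ s = r) ∧
      (r + 1 < 2 ^ m → (Disjoint (P s) (E r) ↔ s = r ∨ s = r + 1)) := by
  induction m with
  | zero => exact ⟨fun _ => ∅, fun _ => ∅, fun _ => ∅, by simp⟩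
  | succ m ih =>
    obtain ⟨P, Q, E, h⟩ := ih
    have hR : 2 ^ (m + 1) = 2 * 2 ^ m := by ring
    have hpos : 0 < 2 ^ m := by positivity
    rw [hR]
    generalize 2 ^ m = R at *
    have key : ∀ S : Finset ℕ, S ⊆ Finset.range (2 * m) →
        2 * m ∉ S ∧ 2 * m + 1 ∉ S ∧ S ⊆ Finset.range (2 * (m + 1)) := by
      intro S hS
      refine ⟨fun hm => ?_, fun hm => ?_, fun x hx => ?_⟩
      · simpa using hS hm
      · simpa using hS hm
      · have := Finset.mem_range.1 (hS hx)
        exact Finset.mem_range.2 (by omega)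
    have hx : 2 * m ∈ Finset.range (2 * (m + 1)) := Finset.mem_range.2 (by omega)
    have hy : 2 * m + 1 ∈ Finset.range (2 * (m + 1)) := Finset.mem_range.2 (by omega)
    have hxy : 2 * m ≠ 2 * m + 1 := by omega
    generalize 2 * m = x at *
    generalize x + 1 = y at *
    generalize Finset.range (2 * (m + 1)) = U at *
    refine ⟨fun r => if r < R then insert x (P r) else insert y (P (2 * R - 1 - r)),
      fun r => if r < R then insert y (Q r) else insert x (Q (2 * R - 1 - r)),
      fun r => if r + 1 < R then insert y (E r) else if r + 1 = R then Q r
        else insert x (E (2 * R - 2 - r)), fun r hr => ?_⟩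
    have hfold : ∀ s < 2 * R, ¬ s < R → 2 * R - 1 - s < R := by omega
    refine ⟨?_, ?_, ?_, ?_, fun hr1 => ⟨?_, ?_⟩, fun s hs => ⟨?_, fun hr1 => ?_⟩⟩
    · dsimp only
      split_ifs with h1
      · obtain ⟨a, -, b, -⟩ := h _ h1
        rw [Finset.card_insert_of_notMem (key _ b).1, a]
      · obtain ⟨a, -, b, -⟩ := h _ (hfold r hr h1)
        rw [Finset.card_insert_of_notMem (key _ b).2.1, a]
    · dsimp only
      split_ifs with h1
      · obtain ⟨-, a, -, b, -⟩ := h _ h1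
        rw [Finset.card_insert_of_notMem (key _ b).2.1, a]
      · obtain ⟨-, a, -, b, -⟩ := h _ (hfold r hr h1)
        rw [Finset.card_insert_of_notMem (key _ b).1, a]
    · dsimp only
      split_ifs with h1
      · exact Finset.insert_subset hx (key _ (h _ h1).2.2.1).2.2
      · exact Finset.insert_subset hy (key _ (h _ (hfold r hr h1)).2.2.1).2.2
    · dsimp only
      split_ifs with h1
      · exact Finset.insert_subset hy (key _ (h _ h1).2.2.2.1).2.2
      · exact Finset.insert_subset hx (key _ (h _ (hfold r hr h1)).2.2.2.1).2.2
    · dsimp only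
      split_ifs with h1 h2
      · obtain ⟨a, b⟩ := (h r (by omega)).2.2.2.2.1 h1
        rw [Finset.card_insert_of_notMem (key _ b).2.1, a]
      · rw [(h r (by omega)).2.1]
      · obtain ⟨a, b⟩ := (h (2 * R - 2 - r) (by omega)).2.2.2.2.1 (by omega)
        rw [Finset.card_insert_of_notMem (key _ b).1, a]
    · dsimp only
      split_ifs with h1 h2
      · exact Finset.insert_subset hy (key _ ((h r (by omega)).2.2.2.2.1 h1).2).2.2
      · exact (key _ (h r (by omega)).2.2.2.1).2.2
      · exact Finset.insert_subset hx
          (key _ ((h (2 * R - 2 - r) (by omega)).2.2.2.2.1 (by omega)).2).2.2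
    · dsimp only
      split_ifs with h1 h2 h2
      · have hP := key _ (h s h1).2.2.1
        have hQ := key _ (h r h2).2.2.2.1
        have := ((h r h2).2.2.2.2.2 s h1).1
        simp [Finset.disjoint_insert_left, Finset.disjoint_insert_right, hP, hQ, hxy.symm, this]
      · have : s ≠ r := by omega
        simp [this]
      · have : s ≠ r := by omega
        simp [this]
      · have hP := key _ (h _ (hfold s hs h1)).2.2.1
        have hQ := key _ (h _ (hfold r hr h2)).2.2.2.1
        have := ((h _ (hfold r hr h2)).2.2.2.2.2 _ (hfold s hs h1)).1
        simp only [Finset.disjoint_insert_left, Finset.disjoint_insert_right, Finset.mem_insert,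
          hP, hQ, hxy, this, or_false, not_false_eq_true, true_and]
        omega
    · dsimp only
      split_ifs with h1 h2 h3 h2 h3
      · have hP := key _ (h s h1).2.2.1
        have hE := key _ ((h r (by omega)).2.2.2.2.1 h2).2
        have := ((h r (by omega)).2.2.2.2.2 s h1).2 h2
        simp [Finset.disjoint_insert_left, Finset.disjoint_insert_right, hP, hE, hxy.symm, this]
      · have hQ := key _ (h r (by omega)).2.2.2.1
        have := ((h r (by omega)).2.2.2.2.2 s h1).1
        simp only [Finset.disjoint_insert_left, hQ, this, not_false_eq_true, true_and]
        omega
      · have : ¬ (s = r ∨ s = r + 1) := by omega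
        simp [this]
      · have : ¬ (s = r ∨ s = r + 1) := by omega
        simp [this]
      · have hQ := key _ (h r (by omega)).2.2.2.1
        have := ((h r (by omega)).2.2.2.2.2 _ (hfold s hs h1)).1
        simp only [Finset.disjoint_insert_left, hQ, this, not_false_eq_true, true_and]
        omega
      · have hP := key _ (h _ (hfold s hs h1)).2.2.1
        have hE := key _ ((h (2 * R - 2 - r) (by omega)).2.2.2.2.1 (by omega)).2
        have := ((h (2 * R - 2 - r) (by omega)).2.2.2.2.2 _ (hfold s hs h1)).2 (by omega)
        simp only [Finset.disjoint_insert_left, Finset.disjoint_insert_right, Finset.mem_insert,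
          hP, hE, hxy, this, or_false, not_false_eq_true, true_and]
        omega

/-- Sets of sizes `2`, `2`, `3` representing the vertices, the edges and the single vertices of
a path on five vertices. -/
theorem exists_path_five_sets (a : ℕ) : ∃ X H W : ℕ → Finset ℕ, ∀ c < 5,
    (X c).card = 2 ∧ (H c).card = 2 ∧ (W c).card = 3 ∧
    X c ⊆ Finset.Ico a (a + 5) ∧ H c ⊆ Finset.Ico a (a + 5) ∧ W c ⊆ Finset.Ico a (a + 5) ∧
    ∀ d < 5, (Disjoint (X d) (W c) ↔ d = c) ∧
      (c + 1 < 5 → (Disjoint (X d) (H c) ↔ d = c ∨ d = c + 1)) := by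
  have key : ∀ c < 5, ∀ d < 5,
      (Disjoint ({d, (d + 1) % 5} : Finset ℕ) {(c + 2) % 5, (c + 3) % 5, (c + 4) % 5} ↔ d = c) ∧
      (c + 1 < 5 → (Disjoint ({d, (d + 1) % 5} : Finset ℕ) {(c + 3) % 5, (c + 4) % 5} ↔
        d = c ∨ d = c + 1)) := by decide
  have card : ∀ c < 5, ({c, (c + 1) % 5} : Finset ℕ).card = 2 ∧
      ({(c + 3) % 5, (c + 4) % 5} : Finset ℕ).card = 2 ∧
      ({(c + 2) % 5, (c + 3) % 5, (c + 4) % 5} : Finset ℕ).card = 3 := by decide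
  have sub : ∀ S : Finset ℕ, (∀ x ∈ S, x < 5) →
      S.map (addLeftEmbedding a) ⊆ Finset.Ico a (a + 5) := by
    intro S hS x hx
    obtain ⟨y, hy, rfl⟩ := Finset.mem_map.1 hx
    have := hS y hy
    simp only [addLeftEmbedding_apply, Finset.mem_Ico]
    omega
  refine ⟨fun c => ({c, (c + 1) % 5} : Finset ℕ).map (addLeftEmbedding a),
    fun c => ({(c + 3) % 5, (c + 4) % 5} : Finset ℕ).map (addLeftEmbedding a),
    fun c => ({(c + 2) % 5, (c + 3) % 5, (c + 4) % 5} : Finset ℕ).map (addLeftEmbedding a),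
    fun c hc => ⟨?_, ?_, ?_, sub _ ?_, sub _ ?_, sub _ ?_, fun d hd => ?_⟩⟩
  · rw [Finset.card_map, (card c hc).1]
  · rw [Finset.card_map, (card c hc).2.1]
  · rw [Finset.card_map, (card c hc).2.2]
  · simp only [Finset.mem_insert, Finset.mem_singleton]
    omega
  · simp only [Finset.mem_insert, Finset.mem_singleton]
    omega
  · simp only [Finset.mem_insert, Finset.mem_singleton]
    omega
  · simp only [Finset.disjoint_map]
    exact key c hc d hd

/-- Adjacency in the infinite grid. -/
def GridAdj (r c r' c' : ℕ) : Prop :=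
  r = r' ∧ (c' = c + 1 ∨ c = c' + 1) ∨ c = c' ∧ (r' = r + 1 ∨ r = r' + 1)

/-- Sets of size `m + 2` representing the vertices and edges of the `2 ^ m × 5` grid, with
disjointness encoding incidence. -/
theorem exists_grid_sets (m : ℕ) : ∃ V : ℕ → ℕ → Finset ℕ,
    (∀ r < 2 ^ m, ∀ c < 5, (V r c).card = m + 2 ∧ V r c ⊆ Finset.range (2 * m + 5)) ∧
    ∀ r < 2 ^ m, ∀ c < 5, ∀ r' < 2 ^ m, ∀ c' < 5, GridAdj r c r' c' →
      ∃ B : Finset ℕ, B.card = m + 2 ∧ B ⊆ Finset.range (2 * m + 5) ∧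
        ∀ s < 2 ^ m, ∀ d < 5, (Disjoint (V s d) B ↔ s = r ∧ d = c ∨ s = r' ∧ d = c') := by
  obtain ⟨P, Q, E, hP⟩ := exists_gray_sets m
  obtain ⟨X, H, W, hX⟩ := exists_path_five_sets (2 * m)
  have disj : ∀ S T : Finset ℕ, S ⊆ Finset.range (2 * m) → T ⊆ Finset.Ico (2 * m) (2 * m + 5) →
      Disjoint S T ∧ S ∪ T ⊆ Finset.range (2 * m + 5) := by
    intro S T hS hT
    constructor
    · refine Finset.disjoint_left.2 fun x h1 h2 => ?_
      have h3 := Finset.mem_range.1 (hS h1)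
      have h4 := Finset.mem_Ico.1 (hT h2)
      omega
    · intro x hx
      rw [Finset.mem_range]
      rcases Finset.mem_union.1 hx with h1 | h1
      · have := Finset.mem_range.1 (hS h1)
        omega
      · exact (Finset.mem_Ico.1 (hT h1)).2
  have union : ∀ S S' T T' : Finset ℕ, S ⊆ Finset.range (2 * m) → S' ⊆ Finset.range (2 * m) →
      T ⊆ Finset.Ico (2 * m) (2 * m + 5) → T' ⊆ Finset.Ico (2 * m) (2 * m + 5) →
      (Disjoint (S ∪ T) (S' ∪ T') ↔ Disjoint S S' ∧ Disjoint T T') := by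
    intro S S' T T' hS hS' hT hT'
    have h1 := (disj S T' hS hT').1
    have h2 := (disj S' T hS' hT).1.symm
    rw [Finset.disjoint_union_left, Finset.disjoint_union_right, Finset.disjoint_union_right]
    tauto
  have horiz : ∀ r < 2 ^ m, ∀ c, c + 1 < 5 → ∃ B : Finset ℕ, B.card = m + 2 ∧
      B ⊆ Finset.range (2 * m + 5) ∧ ∀ s < 2 ^ m, ∀ d < 5,
        (Disjoint (P s ∪ X d) B ↔ s = r ∧ d = c ∨ s = r ∧ d = c + 1) := by
    intro r hr c hc
    obtain ⟨-, q1, -, q2, -, q3⟩ := hP r hr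
    obtain ⟨-, x1, -, -, x2, -, x3⟩ := hX c (by omega)
    refine ⟨Q r ∪ H c, ?_, (disj _ _ q2 x2).2, fun s hs d hd => ?_⟩
    · rw [Finset.card_union_of_disjoint (disj _ _ q2 x2).1, q1, x1]
    · rw [union _ _ _ _ (hP s hs).2.2.1 q2 (hX d hd).2.2.2.1 x2, (q3 s hs).1, (x3 d hd).2 hc]
      tauto
  have vert : ∀ r, r + 1 < 2 ^ m → ∀ c < 5, ∃ B : Finset ℕ, B.card = m + 2 ∧
      B ⊆ Finset.range (2 * m + 5) ∧ ∀ s < 2 ^ m, ∀ d < 5,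
        (Disjoint (P s ∪ X d) B ↔ s = r ∧ d = c ∨ s = r + 1 ∧ d = c) := by
    intro r hr c hc
    obtain ⟨-, -, -, -, q2, q3⟩ := hP r (by omega)
    obtain ⟨q1, q2⟩ := q2 hr
    obtain ⟨-, -, x1, -, -, x2, x3⟩ := hX c hc
    refine ⟨E r ∪ W c, ?_, (disj _ _ q2 x2).2, fun s hs d hd => ?_⟩
    · rw [Finset.card_union_of_disjoint (disj _ _ q2 x2).1, x1]
      omega
    · rw [union _ _ _ _ (hP s hs).2.2.1 q2 (hX d hd).2.2.2.1 x2, (q3 s hs).2 hr, (x3 d hd).1]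
      tauto
  refine ⟨fun r c => P r ∪ X c, fun r hr c hc => ?_, fun r hr c hc r' hr' c' hc' hadj => ?_⟩
  · obtain ⟨q1, -, q2, -⟩ := hP r hr
    obtain ⟨x1, -, -, x2, -⟩ := hX c hc
    refine ⟨?_, (disj _ _ q2 x2).2⟩
    rw [Finset.card_union_of_disjoint (disj _ _ q2 x2).1, q1, x1]
  · rcases hadj with ⟨rfl, rfl | rfl⟩ | ⟨rfl, rfl | rfl⟩
    · exact horiz r hr c hc'
    · obtain ⟨B, h1, h2, h3⟩ := horiz r hr c' hc
      exact ⟨B, h1, h2, fun s hs d hd => (h3 s hs d hd).trans or_comm⟩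
    · exact vert r hr' c hc
    · obtain ⟨B, h1, h2, h3⟩ := vert r' hr c hc
      exact ⟨B, h1, h2, fun s hs d hd => (h3 s hs d hd).trans or_comm⟩

/-- A grid with five columns and an even number of rows has a Hamiltonian cycle. -/
theorem exists_grid_hamiltonian_cycle (R : ℕ) (hR : Even R) : ∃ ρ κ : ℕ → ℕ,
    (∀ i < 5 * R, ρ i < R ∧ κ i < 5) ∧
    (∀ i < 5 * R, ∀ j < 5 * R, ρ i = ρ j → κ i = κ j → i = j) ∧
    ∀ i < 5 * R, GridAdj (ρ i) (κ i) (ρ ((i + 1) % (5 * R))) (κ ((i + 1) % (5 * R))) := by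
  obtain ⟨T, rfl⟩ := hR
  refine ⟨fun s => if s < 8 * T then s / 4 else 10 * T - 1 - s,
    fun s => if s < 8 * T then (if s / 4 % 2 = 0 then 1 + s % 4 else 4 - s % 4) else 0,
    fun i hi => ?_, fun i hi j hj => ?_, fun i hi => ?_⟩
  · dsimp only
    split_ifs <;> omega
  · dsimp only
    split_ifs <;> omega
  · have hmod : i + 1 < 5 * (T + T) ∧ (i + 1) % (5 * (T + T)) = i + 1 ∨
        i + 1 = 5 * (T + T) ∧ (i + 1) % (5 * (T + T)) = 0 := by
      rcases Nat.lt_or_ge (i + 1) (5 * (T + T)) with h | h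
      · exact Or.inl ⟨h, Nat.mod_eq_of_lt h⟩
      · have : i + 1 = 5 * (T + T) := by omega
        exact Or.inr ⟨this, by rw [this, Nat.mod_self]⟩
    unfold GridAdj
    dsimp only
    rcases hmod with ⟨h1, h2⟩ | ⟨h1, h2⟩ <;> rw [h2] <;> split_ifs <;> omega

/-- The zeros in row `i` of `C_{p,2}` are in the columns `i + 1` and `i + 2`, modulo `p + 2`. -/
theorem circulant_two_zero_iff {p i j : ℕ} (hi : i < p + 2) (hj : j < p + 2) :
    ¬ (i + (p + 2) - j) % (p + 2) < p ↔
      j = i + 1 ∨ j = i + 2 ∨ j + (p + 2) = i + 1 ∨ j + (p + 2) = i + 2 := by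
  rcases Nat.lt_or_ge i j with h | h
  · rw [Nat.mod_eq_of_lt (by omega)]
    omega
  · rw [show i + (p + 2) - j = i - j + (p + 2) by omega, Nat.add_mod_right,
      Nat.mod_eq_of_lt (by omega)]
    omega

/-- Two families of `t`-sets of naturals below `k` whose disjointness pattern is the zero pattern
of `C_{p,2}` realise `C_{p,2}` as a submatrix of `A_{k,t}`. -/
theorem isSubmatrixOfA_Cmat_two {k t p : ℕ} (hp : 0 < p) (A B : ℕ → Finset ℕ)
    (hA : ∀ i < p + 2, (A i).card = t ∧ A i ⊆ Finset.range k)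
    (hB : ∀ i < p + 2, (B i).card = t ∧ B i ⊆ Finset.range k)
    (hAB : ∀ i < p + 2, ∀ j < p + 2,
      (Disjoint (A i) (B j) ↔ ¬ (i + (p + 2) - j) % (p + 2) < p)) :
    IsSubmatrixOfA k t (Cmat (p + 2) p) := by
  replace hAB : ∀ i < p + 2, ∀ j < p + 2, (Disjoint (A i) (B j) ↔
      j = i + 1 ∨ j = i + 2 ∨ j + (p + 2) = i + 1 ∨ j + (p + 2) = i + 2) :=
    fun i hi j hj => (hAB i hi j hj).trans (circulant_two_zero_iff hi hj)
  have next : ∀ i < p + 2, ∃ j < p + 2, j = i + 1 ∨ j + (p + 2) = i + 1 := by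
    intro i hi
    rcases Nat.lt_or_ge (i + 1) (p + 2) with h | h
    · exact ⟨i + 1, h, Or.inl rfl⟩
    · exact ⟨0, by omega, by omega⟩
  have prev : ∀ j < p + 2, ∃ i < p + 2, j = i + 1 ∨ j + (p + 2) = i + 1 := by
    intro j hj
    rcases Nat.eq_zero_or_pos j with h | h
    · exact ⟨p + 1, by omega, by omega⟩
    · exact ⟨j - 1, by omega, by omega⟩
  have lt : ∀ S : Finset ℕ, S ⊆ Finset.range k → ∀ x ∈ S, x < k :=
    fun S hS x hx => Finset.mem_range.1 (hS hx)
  refine ⟨fun i => (A i).attachFin (lt _ (hA i i.2).2), fun i => (B i).attachFin (lt _ (hB i i.2).2),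
    fun i i' h => ?_, fun j j' h => ?_, fun i => ?_, fun j => ?_, fun i j => ?_⟩
  · have h' : A i = A i' := by
      simpa only [Finset.map_valEmbedding_attachFin] using congrArg (Finset.map Fin.valEmbedding) h
    obtain ⟨j, hj, hj'⟩ := next i i.2
    obtain ⟨l, hl, hl'⟩ := next j hj
    have h1 := (hAB i' i'.2 j hj).1 (h' ▸ (hAB i i.2 j hj).2 (by omega))
    have h2 := (hAB i' i'.2 l hl).1 (h' ▸ (hAB i i.2 l hl).2 (by omega))
    omega
  · have h' : B j = B j' := by
      simpa only [Finset.map_valEmbedding_attachFin] using congrArg (Finset.map Fin.valEmbedding) h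
    obtain ⟨i, hi, hi'⟩ := prev j j.2
    obtain ⟨l, hl, hl'⟩ := prev i hi
    have h1 := (hAB i hi j' j'.2).1 (h' ▸ (hAB i hi j j.2).2 (by omega))
    have h2 := (hAB l hl j' j'.2).1 (h' ▸ (hAB l hl j j.2).2 (by omega))
    omega
  · rw [Finset.card_attachFin, (hA i i.2).1]
  · rw [Finset.card_attachFin, (hB j j.2).1]
  · have hdisj : Disjoint ((A i).attachFin (lt _ (hA i i.2).2))
        ((B j).attachFin (lt _ (hB j j.2).2)) ↔ Disjoint (A i) (B j) := by
      rw [← Finset.disjoint_map Fin.valEmbedding, Finset.map_valEmbedding_attachFin,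
        Finset.map_valEmbedding_attachFin]
    rw [← not_iff_not, Finset.not_nonempty_iff_eq_empty, ← Finset.disjoint_iff_inter_eq_empty,
      hdisj, hAB i i.2 j j.2, ← circulant_two_zero_iff i.2 j.2, Cmat, decide_eq_true_iff]

/-- for `t > 2`, `q = 2` and `p = 2^t + 2^(t-2) - 2`, there exists
`k₀` such that for every `k ≥ k₀`, `C_{p,2}` is a submatrix of `A_{k,t}`. -/
theorem stmt_13 (t p : ℕ) (ht : 2 < t) (hp : p = 2 ^ t + 2 ^ (t - 2) - 2) :
    ∃ k₀ : ℕ, ∀ k : ℕ, k₀ ≤ k → IsSubmatrixOfA k t (Cmat (p + 2) p) := by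
  obtain ⟨m, rfl⟩ : ∃ m, t = m + 2 := ⟨t - 2, by omega⟩
  have hn : p + 2 = 5 * 2 ^ m := by
    have := Nat.one_le_two_pow (n := m)
    rw [hp, Nat.add_sub_cancel, pow_add]
    omega
  have heven : Even (2 ^ m) := (Nat.even_pow.2 ⟨even_two, by omega⟩)
  obtain ⟨V, hV, hE⟩ := exists_grid_sets m
  obtain ⟨ρ, κ, hlt, hinj, hadj⟩ := exists_grid_hamiltonian_cycle _ heven
  have hmod : ∀ u, (u + 1) % (5 * 2 ^ m) < 5 * 2 ^ m := fun u => Nat.mod_lt _ (by positivity)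
  have edge : ∀ u, ∃ B : Finset ℕ, u < 5 * 2 ^ m → B.card = m + 2 ∧
      B ⊆ Finset.range (2 * m + 5) ∧ ∀ i < 5 * 2 ^ m,
        (Disjoint (V (ρ i) (κ i)) B ↔ i = u ∨ i = (u + 1) % (5 * 2 ^ m)) := by
    intro u
    by_cases hu : u < 5 * 2 ^ m
    · obtain ⟨B, h1, h2, h3⟩ := hE _ (hlt u hu).1 _ (hlt u hu).2 _ (hlt _ (hmod u)).1 _
        (hlt _ (hmod u)).2 (hadj u hu)
      refine ⟨B, fun _ => ⟨h1, h2, fun i hi => ?_⟩⟩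
      rw [h3 _ (hlt i hi).1 _ (hlt i hi).2]
      constructor
      · rintro (⟨a, b⟩ | ⟨a, b⟩)
        · exact Or.inl (hinj _ hi _ hu a b)
        · exact Or.inr (hinj _ hi _ (hmod u) a b)
      · rintro (a | a)
        · exact Or.inl ⟨by rw [a], by rw [a]⟩
        · exact Or.inr ⟨by rw [a], by rw [a]⟩
    · exact ⟨∅, fun h => absurd h hu⟩
  choose B hB using edge
  rw [← hn] at hlt hinj hB
  refine ⟨2 * m + 5, fun k hk => ?_⟩
  have hk' := Finset.range_subset_range.2 hk
  have hu : ∀ j, (j + p) % (p + 2) < p + 2 := fun j => Nat.mod_lt _ (by omega)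
  have hpos : 0 < p := by
    have := Nat.one_le_two_pow (n := m)
    omega
  refine isSubmatrixOfA_Cmat_two hpos (fun i => V (ρ i) (κ i)) (fun j => B ((j + p) % (p + 2)))
    (fun i hi => ?_) (fun j hj => ?_) (fun i hi j hj => ?_)
  · obtain ⟨h1, h2⟩ := hV _ (hlt i hi).1 _ (hlt i hi).2
    exact ⟨h1, h2.trans hk'⟩
  · obtain ⟨h1, h2, -⟩ := hB _ (hu j)
    exact ⟨h1, h2.trans hk'⟩
  · rw [(hB _ (hu j)).2.2 i hi]
    have hj' : 2 ≤ j ∧ (j + p) % (p + 2) = j - 2 ∨ j < 2 ∧ (j + p) % (p + 2) = j + p := by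
      rcases Nat.lt_or_ge j 2 with h | h
      · exact Or.inr ⟨h, Nat.mod_eq_of_lt (by omega)⟩
      · refine Or.inl ⟨h, ?_⟩
        rw [show j + p = j - 2 + (p + 2) by omega, Nat.add_mod_right, Nat.mod_eq_of_lt (by omega)]
    rw [circulant_two_zero_iff hi hj, Nat.mod_add_mod, show j + p + 1 = j + (p + 1) by omega]
    have hj'' : 1 ≤ j ∧ (j + (p + 1)) % (p + 2) = j - 1 ∨
        j = 0 ∧ (j + (p + 1)) % (p + 2) = p + 1 := by
      rcases Nat.eq_zero_or_pos j with h | h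
      · exact Or.inr ⟨h, by rw [h, Nat.zero_add, Nat.mod_eq_of_lt (by omega)]⟩
      · refine Or.inl ⟨h, ?_⟩
        rw [show j + (p + 1) = j - 1 + (p + 2) by omega, Nat.add_mod_right,
          Nat.mod_eq_of_lt (by omega)]
    omega
end

section
/- For every integer k ≥ 5, the matrix C_{5,1} is a submatrix of A_{k,2}; and for every integer k ≥ 6, the matrix C_{5,3} is a submatrix of A_{k,2}. -/
/-- Being a submatrix of `A_{k,t}` is monotone in `k`. -/
theorem IsSubmatrixOfA.mono {k l t n m : ℕ} (h : k ≤ l) {C : Matrix (Fin n) (Fin m) Bool}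
    (hC : IsSubmatrixOfA k t C) : IsSubmatrixOfA l t C := by
  obtain ⟨A, B, hA, hB, hAt, hBt, hAB⟩ := hC
  refine ⟨fun i => (A i).map (Fin.castLEEmb h), fun j => (B j).map (Fin.castLEEmb h),
    (Finset.map_injective _).comp hA, (Finset.map_injective _).comp hB,
    fun i => by simp [hAt], fun j => by simp [hBt], fun i j => ?_⟩
  rw [← Finset.map_inter, Finset.map_nonempty, hAB]

/-- for every `k ≥ 5`, `C_{5,1}` is a submatrix of `A_{k,2}`, and
for every `k ≥ 6`, `C_{5,3}` is a submatrix of `A_{k,2}`. -/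
theorem stmt_14 :
    (∀ k : ℕ, 5 ≤ k → IsSubmatrixOfA k 2 (Cmat (5 + 1) 5)) ∧
    (∀ k : ℕ, 6 ≤ k → IsSubmatrixOfA k 2 (Cmat (5 + 3) 5)) := by
  constructor
  · intro k hk
    refine IsSubmatrixOfA.mono (k := 5) hk
      ⟨![{0, 1}, {0, 2}, {0, 3}, {1, 2}, {1, 3}, {2, 3}],
        ![{0, 1}, {2, 3}, {1, 3}, {1, 2}, {0, 3}, {0, 2}],
        by decide, by decide, by decide, by decide, ?_⟩
    simp only [Cmat]
    decide
  · intro k hk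
    refine IsSubmatrixOfA.mono (k := 6) hk
      ⟨![{0, 1}, {0, 3}, {0, 2}, {2, 5}, {2, 4}, {3, 4}, {1, 4}, {1, 5}],
        ![{0, 2}, {2, 3}, {2, 4}, {4, 5}, {1, 4}, {1, 3}, {0, 1}, {0, 5}],
        by decide, by decide, by decide, by decide, ?_⟩
    simp only [Cmat]
    decide
end

section
/- Let q be a positive integer with q ≠ 1 and q ≠ 3. Then for every integer k ≥ 2, the matrix C_{5,q} is not a submatrix of A_{k,2}. -/
/-- Two pairs of labels, read as unordered sets, have a common label. -/
def pairsMeet (p q : ℕ × ℕ) : Bool :=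
  p.1 == q.1 || p.1 == q.2 || p.2 == q.1 || p.2 == q.2

/-- The pair `p`, placed at position `s`, satisfies the intersection pattern `c` against
the pairs of a list whose last entry is at position `0`. -/
def fitsPattern (c : ℕ → ℕ → Option Bool) (s : ℕ) (p : ℕ × ℕ) : List (ℕ × ℕ) → Bool
  | [] => true
  | q :: l => (c s l.length != some (!pairsMeet p q)) && fitsPattern c s p l

/-- The possible next pairs, up to relabelling, when the labels below `m` are in use,
each with the new number of labels in use. -/
def nextPairs (m : ℕ) : List ((ℕ × ℕ) × ℕ) :=
  ((m, m + 1), m + 2) :: (List.range m).flatMap fun a =>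
    ((a, m), m + 1) :: (List.range a).map fun b => ((b, a), m)

/-- Exhaustive search: `true` means that the partial labelling `l`, using the labels below
`m`, has no extension by `fuel` further pairs with intersection pattern `c`. -/
def refutesExtension (c : ℕ → ℕ → Option Bool) : ℕ → ℕ → List (ℕ × ℕ) → Bool
  | 0, _, _ => false
  | fuel + 1, m, l => (nextPairs m).all fun r =>
      !fitsPattern c l.length r.1 l ||
        refutesExtension c fuel r.2 (r.1 :: l)

/-- The sets `S 0, S 1, …` are the images under `e` of the pairs of `l`, read from its
last entry, whose labels are below `m`. -/
def LabelsSets {α : Type*} [DecidableEq α] (S : ℕ → Finset α) (e : ℕ → α) (m : ℕ) :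
    List (ℕ × ℕ) → Prop
  | [] => True
  | q :: l => (q.1 < m ∧ q.2 < m ∧ S l.length = {e q.1, e q.2}) ∧ LabelsSets S e m l

section Search

variable {α : Type*} [DecidableEq α] {S : ℕ → Finset α} {e e' : ℕ → α} {m m' : ℕ}

lemma LabelsSets.congr (hm : m ≤ m') (he : ∀ a < m, e a = e' a) {l : List (ℕ × ℕ)}
    (h : LabelsSets S e m l) : LabelsSets S e' m' l := by
  induction l with
  | nil => trivial
  | cons q l ih =>
    obtain ⟨⟨h1, h2, h3⟩, h4⟩ := h
    exact ⟨⟨by omega, by omega, by rw [h3, he _ h1, he _ h2]⟩, ih h4⟩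

lemma pairsMeet_iff (he : Set.InjOn e (Set.Iio m)) {p q : ℕ × ℕ} (hp1 : p.1 < m)
    (hp2 : p.2 < m) (hq1 : q.1 < m) (hq2 : q.2 < m) :
    pairsMeet p q = true ↔
      (({e p.1, e p.2} : Finset α) ∩ {e q.1, e q.2}).Nonempty := by
  have key : ∀ a b, a < m → b < m → (e a = e b ↔ a = b) := fun a b ha hb => he.eq_iff ha hb
  simp only [pairsMeet, Bool.or_eq_true, beq_iff_eq, Finset.Nonempty, Finset.mem_inter,
    Finset.mem_insert, Finset.mem_singleton, ← key _ _ hp1 hq1, ← key _ _ hp1 hq2,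
    ← key _ _ hp2 hq1, ← key _ _ hp2 hq2]
  constructor
  · rintro (((h | h) | h) | h)
    exacts [⟨e p.1, by simp [h]⟩, ⟨e p.1, by simp [h]⟩, ⟨e p.2, by simp [h]⟩,
      ⟨e p.2, by simp [h]⟩]
  · rintro ⟨x, rfl | rfl, h | h⟩ <;> simp [h]

lemma fitsPattern_of_labelsSets {c : ℕ → ℕ → Option Bool} {s : ℕ}
    (hc : ∀ x < s, ∀ b, c s x = some b → (b = true ↔ (S s ∩ S x).Nonempty))
    (he : Set.InjOn e (Set.Iio m)) {p : ℕ × ℕ} (hp1 : p.1 < m) (hp2 : p.2 < m)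
    (hp : S s = {e p.1, e p.2}) {l : List (ℕ × ℕ)} (hl : l.length ≤ s)
    (h : LabelsSets S e m l) : fitsPattern c s p l = true := by
  induction l with
  | nil => rfl
  | cons q l ih =>
    obtain ⟨⟨h1, h2, h3⟩, h4⟩ := h
    rw [List.length_cons] at hl
    rw [fitsPattern, Bool.and_eq_true]
    refine ⟨?_, ih (by omega) h4⟩
    have hmeet := pairsMeet_iff he hp1 hp2 h1 h2
    rw [← hp, ← h3] at hmeet
    rw [bne_iff_ne]
    intro hb
    have := hc _ (by omega) _ hb
    rw [← hmeet] at this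
    cases hpq : pairsMeet p q <;> simp [hpq] at this

/-- A two-element set is, after naming its unnamed elements, one of the pairs of
`nextPairs`. -/
lemma exists_mem_nextPairs (he : Set.InjOn e (Set.Iio m)) {T : Finset α} (hT : T.card = 2) :
    ∃ r ∈ nextPairs m, r.1.1 < r.2 ∧ r.1.2 < r.2 ∧ m ≤ r.2 ∧
      ∃ e' : ℕ → α, Set.InjOn e' (Set.Iio r.2) ∧ (∀ a < m, e a = e' a) ∧
        T = {e' r.1.1, e' r.1.2} := by
  obtain ⟨u, v, huv, rfl⟩ := Finset.card_eq_two.mp hT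
  have fresh : ∀ (m : ℕ) (e : ℕ → α) (w : α), Set.InjOn e (Set.Iio m) →
      (∀ a < m, e a ≠ w) → Set.InjOn (Function.update e m w) (Set.Iio (m + 1)) := by
    intro m e w he hw a ha b hb hab
    simp only [Set.mem_Iio] at ha hb
    have hinj : ∀ a b, a < m → b < m → e a = e b → a = b := fun a b ha hb => he ha hb
    simp only [Function.update_apply] at hab
    grind
  have one_new : ∀ u v : α, (∃ a < m, e a = u) → (∀ a < m, e a ≠ v) →
      ∃ r ∈ nextPairs m, r.1.1 < r.2 ∧ r.1.2 < r.2 ∧ m ≤ r.2 ∧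
      ∃ e' : ℕ → α, Set.InjOn e' (Set.Iio r.2) ∧ (∀ a < m, e a = e' a) ∧
        ({u, v} : Finset α) = {e' r.1.1, e' r.1.2} := by
    rintro u v ⟨a, ha, rfl⟩ hv
    refine ⟨((a, m), m + 1), by simp [nextPairs, ha], by simp; omega, by simp,
      by simp, _, fresh m e v he hv, fun b hb => ?_, ?_⟩
    · rw [Function.update_of_ne (by omega)]
    · simp [Function.update_of_ne ha.ne]
  by_cases hu : ∃ a < m, e a = u <;> by_cases hv : ∃ b < m, e b = v
  · obtain ⟨a, ha, rfl⟩ := hu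
    obtain ⟨b, hb, rfl⟩ := hv
    have named : ∀ a b, a < b → b < m → ((a, b), m) ∈ nextPairs m := by
      intro a b hab hb
      simp only [nextPairs, List.mem_cons, List.mem_flatMap, List.mem_range, List.mem_map]
      exact Or.inr ⟨b, hb, Or.inr ⟨a, hab, rfl⟩⟩
    rcases lt_trichotomy a b with hab | rfl | hab
    · exact ⟨((a, b), m), named a b hab hb, ha, hb, le_rfl, e, he,
        fun _ _ => rfl, rfl⟩
    · exact absurd rfl huv
    · exact ⟨((b, a), m), named b a hab ha, hb, ha, le_rfl, e, he,
        fun _ _ => rfl, Finset.pair_comm _ _⟩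
  · exact one_new u v hu (by simpa using hv)
  · rw [Finset.pair_comm]
    exact one_new v u hv (by simpa using hu)
  · push Not at hu hv
    have he1 := fresh m e u he hu
    refine ⟨((m, m + 1), m + 2), by simp [nextPairs], by simp, by simp, by simp, _,
      fresh (m + 1) _ v he1 ?_, fun b hb => ?_, ?_⟩
    · intro a ha
      rcases eq_or_ne a m with rfl | ham
      · simpa using huv
      · rw [Function.update_of_ne ham]
        exact hv a (by omega)
    · rw [Function.update_of_ne (by omega), Function.update_of_ne (by omega)]
    · simp

lemma refutesExtension_sound {c : ℕ → ℕ → Option Bool} {N : ℕ} (hS : ∀ s, (S s).card = 2)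
    (hc : ∀ s < N, ∀ x < s, ∀ b, c s x = some b → (b = true ↔ (S s ∩ S x).Nonempty))
    {fuel : ℕ} {l : List (ℕ × ℕ)} (hN : l.length + fuel ≤ N)
    (he : Set.InjOn e (Set.Iio m)) (hl : LabelsSets S e m l) :
    refutesExtension c fuel m l = false := by
  induction fuel generalizing e m l with
  | zero => rfl
  | succ fuel ih =>
    obtain ⟨r, hr, hr1, hr2, hmr, e', he', hee', hT⟩ :=
      exists_mem_nextPairs he (hS l.length)
    have hl' := hl.congr hmr hee'
    have hfit := fitsPattern_of_labelsSets (hc l.length (by omega)) he' hr1 hr2 hT le_rfl hl'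
    have hrec := ih (l := r.1 :: l) (by rw [List.length_cons]; omega) he'
      ⟨⟨hr1, hr2, hT⟩, hl'⟩
    rw [refutesExtension, List.all_eq_false]
    exact ⟨r, hr, by simp [hfit, hrec]⟩

end Search

/-- The intersection pattern of the sequence row `0`, column `0`, row `1`, column `1`, …
given by a partial matrix `M`. -/
def interleavedPattern (M : ℕ → ℕ → Option Bool) (s x : ℕ) : Option Bool :=
  if s % 2 = 0 then
    if x % 2 = 0 then none else M (s / 2) (x / 2)
  else
    if x % 2 = 0 then M (x / 2) (s / 2) else none

lemma not_isSubmatrixOfA_of_refutesExtension {n k N : ℕ} [NeZero n]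
    {C : Matrix (Fin n) (Fin n) Bool} {M : ℕ → ℕ → Option Bool}
    (hM : ∀ (i j : Fin n) (b : Bool), M i j = some b → C i j = b) (hN : N ≤ 2 * n)
    (h : refutesExtension (interleavedPattern M) N 0 [] = true) :
    ¬ IsSubmatrixOfA k 2 C := by
  rintro ⟨A, B, -, -, hA, hB, hAB⟩
  obtain ⟨v, -⟩ : (A 0).Nonempty := Finset.card_pos.mp (by rw [hA]; norm_num)
  let S : ℕ → Finset (Fin k) := fun s =>
    if s % 2 = 0 then A (Fin.ofNat n (s / 2)) else B (Fin.ofNat n (s / 2))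
  have hS : ∀ s, (S s).card = 2 := by
    intro s
    simp only [S]
    split_ifs
    exacts [hA _, hB _]
  have hentry : ∀ i j b, i < n → j < n → M i j = some b →
      (b = true ↔ (A (Fin.ofNat n i) ∩ B (Fin.ofNat n j)).Nonempty) := by
    intro i j b hi hj hb
    rw [← hAB, hM _ _ b]
    simpa [Fin.ofNat, Nat.mod_eq_of_lt hi, Nat.mod_eq_of_lt hj] using hb
  have hc : ∀ s < N, ∀ x < s, ∀ b, interleavedPattern M s x = some b →
      (b = true ↔ (S s ∩ S x).Nonempty) := by
    intro s hs x hx b hb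
    simp only [interleavedPattern] at hb
    simp only [S]
    split_ifs at hb ⊢
    · exact hentry _ _ b (by omega) (by omega) hb
    · rw [Finset.inter_comm]
      exact hentry _ _ b (by omega) (by omega) hb
  have := refutesExtension_sound (e := fun _ => v) (m := 0) (l := []) (fuel := N) hS hc
    (by simp) (by simp [Set.InjOn]) trivial
  simp [h] at this

lemma refutesExtension_cyclic_seven :
    refutesExtension
      (interleavedPattern fun i j => some (decide ((i + 7 - j) % 7 < 5))) 13 0 [] = true := by
  decide +kernel

/-- The entries of `C_{5,q}` that do not depend on `q` once `q ≥ 4`. -/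
def bandEntry (i j : ℕ) : Option Bool :=
  if j ≤ i then some (decide (i - j < 5)) else if j ≤ i + 4 then some false else none

lemma refutesExtension_band :
    refutesExtension (interleavedPattern bandEntry) 12 0 [] = true := by
  decide +kernel

lemma Cmat_eq_of_bandEntry {n : ℕ} (hn : 9 ≤ n) (i j : Fin n) (b : Bool)
    (h : bandEntry i j = some b) : Cmat n 5 i j = b := by
  have hi := i.isLt
  have hj := j.isLt
  rw [bandEntry] at h
  rw [Cmat]
  split_ifs at h with h1 h2
  · rw [show i.val + n - j.val = i.val - j.val + n by omega, Nat.add_mod_right,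
      Nat.mod_eq_of_lt (by omega)]
    exact Option.some_injective _ h
  · rw [Nat.mod_eq_of_lt (by omega), ← Option.some_injective _ h]
    exact decide_eq_false (by omega)

/-- for every positive `q` with `q ≠ 1` and `q ≠ 3`, and every
`k ≥ 2`, the matrix `C_{5,q}` is not a submatrix of `A_{k,2}`. -/
theorem stmt_15 (q : ℕ) (hq : 0 < q) (hq1 : q ≠ 1) (hq3 : q ≠ 3) :
    ∀ k : ℕ, 2 ≤ k → ¬ IsSubmatrixOfA k 2 (Cmat (5 + q) 5) := by
  intro k _
  obtain rfl | hq4 : q = 2 ∨ 4 ≤ q := by omega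
  · exact not_isSubmatrixOfA_of_refutesExtension
      (fun _ _ _ h => Option.some_injective _ h) (by norm_num) refutesExtension_cyclic_seven
  · have : NeZero (5 + q) := ⟨by omega⟩
    exact not_isSubmatrixOfA_of_refutesExtension
      (Cmat_eq_of_bandEntry (by omega)) (by omega) refutesExtension_band
end

section
/- Let t ≥ 1 and k ≥ 2t be integers, and let p = C(2t, t) − 1, where C(2t, t) is the binomial coefficient '2t choose t'. Then C_{p,1} is a submatrix of A_{k,t}; in particular, taking as row and column indices all t-element subsets of [2t] (suitably ordered) realizes C_{p,1} as a submatrix of A_{k,t} of size C(2t,t) × C(2t,t). -/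
/-- The only zero of `C_{p,1}` in column `j` is in the row cyclically preceding `j`. -/
theorem Cmat_succ_eq_true_iff (p : ℕ) (i j : Fin (p + 1)) :
    Cmat (p + 1) p i j = true ↔ i ≠ j - 1 := by
  have hval : (i.val + (p + 1) - j.val) % (p + 1) = (i - j).val := by
    rw [Fin.val_sub]
    congr 1
    omega
  have hlast : Fin.last p = -1 := eq_neg_of_add_eq_zero_left (Fin.last_add_one p)
  have hlt : (i - j).val < p ↔ i - j ≠ Fin.last p := by
    rw [Ne, Fin.ext_iff, Fin.val_last]
    omega
  rw [Cmat, decide_eq_true_iff, hval, hlt, hlast, Ne, Ne, sub_eq_iff_eq_add,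
    neg_add_eq_sub]

/-- If `s ⊆ U` and `u` has as many elements as `s`, then `s` meets the complement of `u`
in `U` iff `s ≠ u`. -/
theorem inter_sdiff_nonempty_iff_ne {α : Type*} [DecidableEq α] {U s u : Finset α}
    (hs : s ⊆ U) (hcard : s.card = u.card) :
    (s ∩ (U \ u)).Nonempty ↔ s ≠ u := by
  rw [← Finset.inter_sdiff_assoc, Finset.inter_eq_left.mpr hs, Finset.sdiff_nonempty, not_iff_not]
  exact ⟨fun h => Finset.eq_of_subset_of_card_le h hcard.ge, fun h => h.le⟩

/-- for `t ≥ 1`, `k ≥ 2t` and `p = C(2t,t) - 1`, the matrix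
`C_{p,1}` (of size `C(2t,t) × C(2t,t)`) is a submatrix of `A_{k,t}`; moreover it
can be realized using as row and column indices all `t`-element subsets of `[2t]`
(suitably ordered). -/
theorem stmt_17 (t k p : ℕ) (ht : 1 ≤ t) (hk : 2 * t ≤ k)
    (hp : p = Nat.choose (2 * t) t - 1) :
    IsSubmatrixOfA k t (Cmat (p + 1) p) ∧
    ∃ (A B : Fin (p + 1) → Finset (Fin k)),
      Function.Injective A ∧ Function.Injective B ∧
      (∀ i, (A i).card = t) ∧ (∀ j, (B j).card = t) ∧
      (∀ i, A i ⊆ Finset.univ.filter fun x : Fin k => x.val < 2 * t) ∧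
      (∀ j, B j ⊆ Finset.univ.filter fun x : Fin k => x.val < 2 * t) ∧
      (∀ i j, Cmat (p + 1) p i j = true ↔ ((A i) ∩ (B j)).Nonempty) := by
  have key : ∃ (A B : Fin (p + 1) → Finset (Fin k)),
      Function.Injective A ∧ Function.Injective B ∧
      (∀ i, (A i).card = t) ∧ (∀ j, (B j).card = t) ∧
      (∀ i, A i ⊆ Finset.univ.filter fun x : Fin k => x.val < 2 * t) ∧
      (∀ j, B j ⊆ Finset.univ.filter fun x : Fin k => x.val < 2 * t) ∧
      (∀ i j, Cmat (p + 1) p i j = true ↔ ((A i) ∩ (B j)).Nonempty) := by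
    set U : Finset (Fin k) := Finset.univ.filter fun x : Fin k => x.val < 2 * t with hU
    have hUcard : U.card = 2 * t := by
      rw [hU, Fin.card_filter_val_lt, min_eq_right hk]
    have hS : (Finset.powersetCard t U).card = p + 1 := by
      have := Nat.choose_pos (show t ≤ 2 * t by omega)
      rw [Finset.card_powersetCard, hUcard]
      omega
    let e := ((Finset.powersetCard t U).equivFinOfCardEq hS).symm
    let A : Fin (p + 1) → Finset (Fin k) := fun i => e i
    have hA : Function.Injective A := Subtype.val_injective.comp e.injective
    have hmem (i) : A i ⊆ U ∧ (A i).card = t := Finset.mem_powersetCard.mp (e i).2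
    refine ⟨A, fun j => U \ A (j - 1), hA, fun j l h => ?_, fun i => (hmem i).2, fun j => ?_,
      fun i => (hmem i).1, fun j => Finset.sdiff_subset, fun i j => ?_⟩
    · have h' : A (j - 1) = A (l - 1) := by
        rw [← Finset.sdiff_sdiff_eq_self (hmem (j - 1)).1,
          ← Finset.sdiff_sdiff_eq_self (hmem (l - 1)).1]
        exact congrArg (U \ ·) h
      exact sub_left_injective (hA h')
    · rw [Finset.card_sdiff_of_subset (hmem _).1, hUcard, (hmem _).2]
      omega
    · rw [Cmat_succ_eq_true_iff,
        inter_sdiff_nonempty_iff_ne (hmem i).1 ((hmem i).2.trans (hmem _).2.symm), hA.ne_iff]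
  obtain ⟨A, B, hA, hB, hAc, hBc, hAU, hBU, h⟩ := key
  exact ⟨⟨A, B, hA, hB, hAc, hBc, h⟩, A, B, hA, hB, hAc, hBc, hAU, hBU, h⟩
end

section
/- Let k, t, p, q be integers with k ≥ 2t, t ≥ 1, p ≥ 1, q ≥ 1 and q ≥ p − 1. If C_{p,q} is a submatrix of A_{k,t}, then p + q ≤ k. -/
/-- If `2 * p ≤ n + 1`, no two distinct diagonal positions of `Cmat n p` span an all-one
`2 × 2` submatrix. -/
theorem Cmat_not_symm {n p : ℕ} (hn : 2 * p ≤ n + 1) {i j : Fin n} (hij : i ≠ j) :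
    ¬(Cmat n p i j = true ∧ Cmat n p j i = true) := by
  wlog hlt : i < j generalizing i j
  · exact fun h => this hij.symm (lt_of_le_of_ne (not_lt.1 hlt) hij.symm) h.symm
  simp only [Cmat, decide_eq_true_eq]
  have hlt' : i.val < j.val := hlt
  have hj := j.isLt
  rw [Nat.mod_eq_of_lt (show i.val + n - j.val < n by omega),
    show j.val + n - i.val = (j.val - i.val) + n by omega, Nat.add_mod_right,
    Nat.mod_eq_of_lt (by omega)]
  omega

/-- for `k ≥ 2t`, `t ≥ 1`, `p, q ≥ 1` and `q ≥ p - 1`, if `C_{p,q}`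
is a submatrix of `A_{k,t}` then `p + q ≤ k`. -/
theorem stmt_18 (k t p q : ℕ) (ht : 1 ≤ t) (hk : 2 * t ≤ k)
    (hp : 1 ≤ p) (hq : 1 ≤ q) (hqp : p - 1 ≤ q)
    (h : IsSubmatrixOfA k t (Cmat (p + q) p)) :
    p + q ≤ k := by
  obtain ⟨A, B, -, -, -, -, hAB⟩ := h
  have hdiag : ∀ i, (A i ∩ B i).Nonempty := fun i => (hAB i i).1 <| by
    simp only [Cmat, decide_eq_true_eq, Nat.add_sub_cancel_left, Nat.mod_self]
    omega
  choose f hf using hdiag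
  have hinj : Function.Injective f := by
    intro i j hij
    by_contra hne
    refine Cmat_not_symm (n := p + q) (p := p) (by omega) hne ⟨(hAB i j).2 ⟨f i, ?_⟩, (hAB j i).2 ⟨f i, ?_⟩⟩
    · exact Finset.mem_inter.2 ⟨Finset.mem_of_mem_inter_left (hf i),
        hij ▸ Finset.mem_of_mem_inter_right (hf j)⟩
    · exact Finset.mem_inter.2 ⟨hij ▸ Finset.mem_of_mem_inter_left (hf j),
        Finset.mem_of_mem_inter_right (hf i)⟩
  simpa using Fintype.card_le_of_injective f hinj
end
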